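/- (Bressoud's theorem) For all integers ν ≥ 1, 0 ≤ s ≤ ν, every tuple n = (n_1,…,n_ν) of nonnegative integers, and all complex q with |q| < 1: the limit as L → ∞ of Σ_{p ∈ P^ν_{0,L}(ν−s,0,n)} q^{w(p)} equals q^{N_1²+⋯+N_ν²+N_{s+1}+⋯+N_ν} / ((q)_{n_1}(q)_{n_2}⋯(q)_{n_ν}). -/

import Mathlib

open scoped Classical

noncomputable section

/-- The q-Pochhammer symbol `(q)_n = ∏_{j=1}^n (1 - q^j)`. -/
def qP {F : Type*} [Field F] (q : F) (n : ℕ) : F :=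
  ∏ j ∈ Finset.range n, (1 - q ^ (j + 1))

/-- The q-binomial coefficient `[N choose k]_q = (q)_N / ((q)_k (q)_{N-k})`
for `0 ≤ k ≤ N`, and `0` otherwise. -/
def qB {F : Type*} [Field F] (q : F) (N k : ℤ) : F :=
  if 0 ≤ k ∧ k ≤ N then qP q N.toNat / (qP q k.toNat * qP q (N - k).toNat) else 0

/-- `NN n i = N_i = n_i + n_{i+1} + ⋯ + n_ν` (indices 1-based; `n ⟨k⟩` is `n_{k+1}`). -/
def NN {ν : ℕ} (n : Fin ν → ℕ) (i : ℕ) : ℕ :=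
  ∑ k : Fin ν, if i ≤ (k : ℕ) + 1 then n k else 0

/-- `α_{i,s} = max(0, i - s)`. -/
def alph (i s : ℕ) : ℤ := max 0 ((i : ℤ) - s)

/-- The exponent `N_1² + ⋯ + N_ν² + N_{s+1} + ⋯ + N_ν`. -/
def expAG (ν s : ℕ) (nn : Fin ν → ℕ) : ℕ :=
  (∑ i ∈ Finset.Icc 1 ν, (NN nn i) ^ 2) + ∑ i ∈ Finset.Icc (s + 1) ν, NN nn i

/-- The polynomial `B^ν_{s,b}(L,q)` of Foda–Quano–Kirillov type. -/
def B {F : Type*} [Field F] (ν : ℕ) (s b : ℤ) (L : ℕ) (q : F) : F :=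
  ∑ᶠ j : ℤ,
    (q ^ (j * ((2 * j + 1) * (2 * (ν : ℤ) + 3) - 2 * s)) *
        qB q (L : ℤ) (((L : ℤ) + b - s) / 2 + j * (2 * (ν : ℤ) + 3)) -
      q ^ ((2 * j + 1) * ((2 * (ν : ℤ) + 3) * j + s)) *
        qB q (L : ℤ) (((L : ℤ) + b + s) / 2 + j * (2 * (ν : ℤ) + 3)))

/-- `jjf j l = j_l` for `1 ≤ l ≤ ν` (and junk value `0` otherwise). -/
def jjf {ν : ℕ} (j : Fin ν → ℕ) (l : ℕ) : ℤ :=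
  if h : l - 1 < ν then (j ⟨l - 1, h⟩ : ℤ) else 0

/-- The q-multinomial coefficient `[L choose a]^(p)_ν`. -/
def qMulti {F : Type*} [Field F] (ν L : ℕ) (a : ℤ) (p : ℕ) (q : F) : F :=
  ∑ᶠ j : Fin ν → ℕ,
    if (∑ l, (j l : ℤ)) = a then
      q ^ ((∑ l ∈ Finset.Icc 2 ν, jjf j (l - 1) * ((L : ℤ) - jjf j l)) -
            ∑ l ∈ Finset.Icc 1 p, jjf j l) *
        qB q (L : ℤ) (jjf j ν) * ∏ l ∈ Finset.Icc 2 ν, qB q (jjf j l) (jjf j (l - 1))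
    else 0

/-- The polynomial `W^ν_{s,b}(L,q)` of Warnaar type. -/
def W {F : Type*} [Field F] (ν : ℕ) (s : ℤ) (b L : ℕ) (q : F) : F :=
  ∑ᶠ j : ℤ,
    (q ^ (j * ((2 * j + 1) * (2 * (ν : ℤ) + 3) - 2 * s)) *
        qMulti ν L (((ν : ℤ) * ((L : ℤ) + 1) - s - b + 1) / 2 + (2 * (ν : ℤ) + 3) * j) b q -
      q ^ ((2 * j + 1) * ((2 * (ν : ℤ) + 3) * j + s)) *
        qMulti ν L (((ν : ℤ) * ((L : ℤ) + 1) + s - b + 1) / 2 + (2 * (ν : ℤ) + 3) * j) b q)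

/-! ### Bressoud lattice paths -/

/-- Step values: `0 ↦ NE (+1)`, `1 ↦ SE (−1)`, `2 ↦ horizontal (0)`. -/
def stepVal : Fin 3 → ℤ := ![1, -1, 0]

/-- Height of the path after `k` steps, starting at height `s`. -/
def hts (s : ℤ) {n : ℕ} (d : Fin n → Fin 3) (k : ℕ) : ℤ :=
  s + ∑ i ∈ Finset.range k, if h : i < n then stepVal (d ⟨i, h⟩) else 0

/-- The vertex `k` is a peak: it is preceded by a NE step and followed by a SE step. -/
def IsPeak {n : ℕ} (d : Fin n → Fin 3) (k : ℕ) : Prop :=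
  ∃ hk : k < n, 1 ≤ k ∧ d ⟨k - 1, Nat.lt_of_le_of_lt (Nat.sub_le k 1) hk⟩ = 0 ∧ d ⟨k, hk⟩ = 1

/-- `d` encodes a Bressoud path from height `s` to height `b` whose peaks have height `≤ ν`:
SE steps only from positive height, horizontal steps only on the x-axis. -/
def ValidPath (ν : ℕ) (s b : ℤ) {n : ℕ} (d : Fin n → Fin 3) : Prop :=
  hts s d n = b ∧
    (∀ k : Fin n, (d k = 1 → 0 < hts s d (k : ℕ)) ∧ (d k = 2 → hts s d (k : ℕ) = 0)) ∧
    (∀ k : ℕ, IsPeak d k → hts s d k ≤ (ν : ℤ))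

/-- The weight of a Bressoud path starting at x-coordinate `M`:
the sum of the x-coordinates of its peaks. -/
def pwt (M : ℤ) {n : ℕ} (d : Fin n → Fin 3) : ℤ :=
  ∑ k ∈ Finset.range (n + 1), if IsPeak d k then M + (k : ℤ) else 0

/-- `C^ν_{M,L}(s,b,q)`: the weighted count of Bressoud paths from `(M,s)` to `(L,b)`
with no peak higher than `ν`. -/
def Cpoly {F : Type*} [Field F] (ν : ℕ) (M L : ℤ) (s b : ℕ) (q : F) : F :=
  ∑ d ∈ Finset.univ.filter (fun d : Fin (L - M).toNat → Fin 3 => ValidPath ν (s : ℤ) (b : ℤ) d),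
    q ^ pwt M d

/-- `t` is an admissible relative height for the peak at vertex `k`. -/
def RelProp (s : ℤ) {n : ℕ} (d : Fin n → Fin 3) (k t : ℕ) : Prop :=
  0 < t ∧ ∃ k' k'' : ℕ, k' < k ∧ k < k'' ∧ k'' ≤ n ∧
    hts s d k' = hts s d k - t ∧ hts s d k'' = hts s d k - t ∧
    ∀ m : ℕ, k' < m → m < k'' → IsPeak d m →
      hts s d m ≤ hts s d k ∧ (hts s d m = hts s d k → k ≤ m)

/-- The relative height of the peak at vertex `k`: the largest `t` with `RelProp`. -/
def relHt (ν : ℕ) (s : ℤ) {n : ℕ} (d : Fin n → Fin 3) (k : ℕ) : ℕ :=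
  Nat.findGreatest (RelProp s d k) (ν + n)

/-- `P^ν_{M,L}(s,b,n)`: Bressoud paths from `(M,s)` to `(L,b)`, peaks of height at most `ν`,
with exactly `nn j` peaks of relative height `j+1`. -/
def Pset (ν : ℕ) (M L : ℤ) (s b : ℤ) (nn : Fin ν → ℕ) : Finset (Fin (L - M).toNat → Fin 3) :=
  Finset.univ.filter (fun d => ValidPath ν s b d ∧
    ∀ j : Fin ν, ((Finset.range ((L - M).toNat + 1)).filter
      (fun k => IsPeak d k ∧ relHt ν s d k = (j : ℕ) + 1)).card = nn j)

/-! ### Gordon lattice paths -/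

/-- `f` encodes a Gordon path of length `n` from height `s` to height `b`:
`f 0 = s`, `f n = b`, adjacent frequencies sum to at most `ν`; values beyond `n` are `0`. -/
def IsGordon (ν n s b : ℕ) (f : ℕ → ℕ) : Prop :=
  f 0 = s ∧ f n = b ∧ (∀ k, k < n → f k + f (k + 1) ≤ ν) ∧ (∀ k, n < k → f k = 0)

/-- The weight `Σ_{j=M+1}^{L-1} j f_j` of a Gordon path starting at x-coordinate `M`. -/
def gwt (M : ℤ) (n : ℕ) (f : ℕ → ℕ) : ℤ :=
  ∑ k ∈ Finset.Ioo 0 n, (M + (k : ℤ)) * (f k : ℤ)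

/-- `G^ν_{M,L}(s,b,q)`: the weighted count of Gordon paths from `(M,s)` to `(L,b)`. -/
def G {F : Type*} [Field F] (ν : ℕ) (M L : ℤ) (s b : ℕ) (q : F) : F :=
  ∑ᶠ f : ℕ → ℕ, if IsGordon ν (L - M).toNat s b f then q ^ gwt M (L - M).toNat f else 0

/-- `F^ν_{s,b}(L,q)` of (2.21). -/
def Fpoly {F : Type*} [Field F] (ν s b L : ℕ) (q : F) : F :=
  ∑ᶠ nn : Fin ν → ℕ, q ^ expAG ν s nn *
    ∏ i : Fin ν, qB q ((nn i : ℤ) + ((i : ℕ) + 1) * (L : ℤ) -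
      2 * (∑ l ∈ Finset.Icc 1 ((i : ℕ) + 1), (NN nn l : ℤ)) -
      alph ((i : ℕ) + 1) s - alph ((i : ℕ) + 1) b) (nn i)

/-- The left-hand side of (4.2): `F` with the extra `−M(N_1+⋯+N_ν)` in the exponent. -/
def FpolyM {F : Type*} [Field F] (ν s b L M : ℕ) (q : F) : F :=
  ∑ᶠ nn : Fin ν → ℕ,
    q ^ ((expAG ν s nn : ℤ) - (M : ℤ) * ∑ i ∈ Finset.Icc 1 ν, (NN nn i : ℤ)) *
    ∏ i : Fin ν, qB q ((nn i : ℤ) + ((i : ℕ) + 1) * (L : ℤ) -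
      2 * (∑ l ∈ Finset.Icc 1 ((i : ℕ) + 1), (NN nn l : ℤ)) -
      alph ((i : ℕ) + 1) s - alph ((i : ℕ) + 1) b) (nn i)


abbrev K : Type := RatFunc ℚ



/-! ### Abstract height functions -/

/-- Vertex `k` is a peak of the height function `H` on `[0, L]`. -/
def Pk (H : ℕ → ℤ) (L k : ℕ) : Prop :=
  1 ≤ k ∧ k < L ∧ H (k - 1) + 1 = H k ∧ H (k + 1) + 1 = H k

/-- Valid steps, ending at height `0`, starting nonnegative. -/
def VP (H : ℕ → ℤ) (L : ℕ) : Prop :=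
  (∀ k, k < L → H (k + 1) = H k + 1 ∨ (H (k + 1) = H k - 1 ∧ 0 < H k) ∨
    (H (k + 1) = H k ∧ H k = 0)) ∧ H L = 0 ∧ 0 ≤ H 0

/-- The relative height property in terms of heights. -/
def RP (H : ℕ → ℤ) (L k t : ℕ) : Prop :=
  0 < t ∧ ∃ k' k'' : ℕ, k' < k ∧ k < k'' ∧ k'' ≤ L ∧
    H k' = H k - t ∧ H k'' = H k - t ∧
    ∀ m : ℕ, k' < m → m < k'' → Pk H L m → H m ≤ H k ∧ (H m = H k → k ≤ m)

theorem VP.nonneg {H : ℕ → ℤ} {L : ℕ} (h : VP H L) : ∀ k, k ≤ L → 0 ≤ H k := by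
  intro k
  induction k with
  | zero => intro _; exact h.2.2
  | succ k ih =>
    intro hk
    have := ih (by omega)
    rcases h.1 k (by omega) with h1 | h1 | h1 <;> omega

/-- Leftmost maximum in an interval is a peak. -/
theorem VP.exists_max {H : ℕ → ℤ} {L : ℕ} (h : VP H L) {a b x : ℕ} (hax : a < x) (hxb : x < b)
    (hb : b ≤ L) (h1 : H a < H x) (h2 : H b < H x) :
    ∃ m, a < m ∧ m < b ∧ Pk H L m ∧ (∀ z, a ≤ z → z ≤ b → H z ≤ H m) ∧
      (∀ z, a ≤ z → z < m → H z < H m) := by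
  obtain ⟨m0, hm0, hmax⟩ := Finset.exists_max_image (Finset.Icc a b) H ⟨x, by simp; omega⟩
  have hex : ∃ m, (a ≤ m ∧ m ≤ b) ∧ H m = H m0 := ⟨m0, by simpa using hm0, rfl⟩
  obtain ⟨⟨ha, hb'⟩, hm⟩ := Nat.find_spec hex
  set m := Nat.find hex with hmdef
  have hmin : ∀ z, a ≤ z → z < m → H z < H m := by
    intro z hz hzm
    have := Nat.find_min hex hzm
    have h3 := hmax z (by simp; omega)
    rcases lt_or_eq_of_le h3 with h4 | h4
    · omega
    · exact absurd ⟨⟨hz, by omega⟩, h4⟩ this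
  have hall : ∀ z, a ≤ z → z ≤ b → H z ≤ H m := by
    intro z hz hzb; rw [hm]; exact hmax z (by simp; omega)
  have hx := hall x (by omega) (by omega)
  have ham : a < m := by
    rcases Nat.lt_or_ge a m with h5 | h5
    · exact h5
    · have : a = m := by omega
      rw [this] at h1; omega
  have hmb : m < b := by
    rcases Nat.lt_or_ge m b with h5 | h5
    · exact h5
    · have : b = m := by omega
      rw [this] at h2; omega
  have hpos : 0 < H m := by
    have := h.nonneg a (by omega); omega
  refine ⟨m, ham, hmb, ⟨by omega, by omega, ?_, ?_⟩, hall, hmin⟩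
  · have h5 := h.1 (m - 1) (by omega)
    have h6 := hmin (m - 1) (by omega) (by omega)
    rw [Nat.sub_add_cancel (by omega)] at h5
    omega
  · have h5 := h.1 m (by omega)
    have h6 := hall (m + 1) (by omega) (by omega)
    omega

/-- last vertex before `k` at given level -/
theorem VP.ivt_left {H : ℕ → ℤ} {L : ℕ} (h : VP H L) {a k : ℕ} (hak : a < k) (hk : k ≤ L)
    {v : ℤ} (h1 : H a ≤ v) (h2 : v < H k) : ∃ z, a ≤ z ∧ z < k ∧ H z = v := by
  induction k with
  | zero => omega
  | succ k ih =>
    have hs := h.1 k (by omega)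
    by_cases hv : H k = v
    · exact ⟨k, by omega, by omega, hv⟩
    · have : a ≠ k := by rintro rfl; omega
      obtain ⟨z, h3, h4, h5⟩ := ih (by omega) (by omega) (by omega)
      exact ⟨z, h3, by omega, h5⟩

theorem VP.ivt_right {H : ℕ → ℤ} {L : ℕ} (h : VP H L) {k b : ℕ} (hkb : k < b) (hb : b ≤ L)
    {v : ℤ} (h1 : H b ≤ v) (h2 : v < H k) : ∃ z, k < z ∧ z ≤ b ∧ H z = v := by
  induction b with
  | zero => omega
  | succ b ih =>
    have hs := h.1 b (by omega)
    by_cases hv : H (b + 1) = v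
    · exact ⟨b + 1, by omega, by omega, hv⟩
    · have : k ≠ b := by rintro rfl; omega
      obtain ⟨z, h3, h4, h5⟩ := ih (by omega) (by omega) (by omega)
      exact ⟨z, h3, by omega, h5⟩

/-- It is enough to have the window ends at or below the level. -/
theorem VP.RP_of_weak {H : ℕ → ℤ} {L : ℕ} (h : VP H L) {k t k' k'' : ℕ} (ht : 0 < t)
    (h1 : k' < k) (h2 : k < k'') (h3 : k'' ≤ L) (h4 : H k' ≤ H k - t) (h5 : H k'' ≤ H k - t)
    (h6 : ∀ m : ℕ, k' < m → m < k'' → Pk H L m → H m ≤ H k ∧ (H m = H k → k ≤ m)) :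
    RP H L k t := by
  obtain ⟨z, hz1, hz2, hz3⟩ := h.ivt_left h1 (by omega) h4 (by omega)
  obtain ⟨y, hy1, hy2, hy3⟩ := h.ivt_right h2 h3 h5 (by omega)
  exact ⟨ht, z, y, hz2, hy1, by omega, hz3, hy3, fun m hm1 hm2 => h6 m (by omega) (by omega)⟩

theorem VP.RP_mono {H : ℕ → ℤ} {L : ℕ} (h : VP H L) {k t u : ℕ} (ht : 0 < t) (htu : t ≤ u)
    (hu : RP H L k u) : RP H L k t := by
  obtain ⟨_, k', k'', h1, h2, h3, h4, h5, h6⟩ := hu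
  exact h.RP_of_weak ht h1 h2 h3 (by omega) (by omega) h6

theorem VP.RP_one {H : ℕ → ℤ} {L k : ℕ} (hk : Pk H L k) : RP H L k 1 := by
  obtain ⟨h1, h2, h3, h4⟩ := hk
  refine ⟨by omega, k - 1, k + 1, by omega, by omega, by omega, by push_cast; omega,
    by push_cast; omega, ?_⟩
  intro m hm1 hm2 _
  have : m = k := by omega
  subst this
  exact ⟨le_refl _, fun _ => le_refl _⟩

theorem VP.RP_le {H : ℕ → ℤ} {L k t : ℕ} (h : VP H L) (hk : RP H L k t) : (t : ℤ) ≤ H k := by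
  obtain ⟨_, k', k'', h1, h2, h3, h4, h5, h6⟩ := hk
  have := h.nonneg k' (by omega)
  omega

/-- All heights in the window (not just the peaks) are bounded. -/
theorem VP.RP_all {H : ℕ → ℤ} {L : ℕ} (h : VP H L) {k k' k'' : ℕ} {v : ℤ}
    (h1 : k' < k) (h2 : k < k'') (h3 : k'' ≤ L) (h4 : H k' ≤ v) (h5 : H k'' ≤ v) (hv : v < H k)
    (h6 : ∀ m : ℕ, k' < m → m < k'' → Pk H L m → H m ≤ H k ∧ (H m = H k → k ≤ m)) :
    ∀ m : ℕ, k' < m → m < k'' → H m ≤ H k ∧ (H m = H k → k ≤ m) := by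
  obtain ⟨m, hm1, hm2, hm3, hm4, hm5⟩ := h.exists_max h1 h2 h3 (by omega) (by omega)
  have h7 := h6 m hm1 hm2 hm3
  have h8 := hm4 k (by omega) (by omega)
  intro z hz1 hz2
  have h9 := hm4 z (by omega) (by omega)
  refine ⟨by omega, fun hz => ?_⟩
  by_contra hc
  have := hm5 z (by omega) (by omega)
  omega

/-- `Ex` : the relative height of `k` is exactly `t`. -/
def Ex (H : ℕ → ℤ) (L k t : ℕ) : Prop := RP H L k t ∧ ¬ RP H L k (t + 1)

theorem VP.findGreatest_iff {H : ℕ → ℤ} {L k : ℕ} (h : VP H L) {B t : ℕ} (hB : H k ≤ B)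
    (ht : 0 < t) : Nat.findGreatest (RP H L k) B = t ↔ Ex H L k t := by
  constructor
  · intro he
    have h1 : RP H L k t := Nat.findGreatest_of_ne_zero he (by omega)
    refine ⟨h1, fun h2 => ?_⟩
    have h3 := h.RP_le h2
    have := Nat.le_findGreatest (P := RP H L k) (m := t + 1) (n := B) (by push_cast at h3; omega) h2
    omega
  · rintro ⟨h1, h2⟩
    have h3 := h.RP_le h1
    have h4 := Nat.le_findGreatest (P := RP H L k) (m := t) (n := B) (by omega) h1
    by_contra hne
    have h5 : RP H L k (Nat.findGreatest (RP H L k) B) :=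
      Nat.findGreatest_spec (m := t) (by omega) h1
    exact h2 (h.RP_mono (by omega) (by omega) h5)

/-- The set of peaks. -/
def pks (H : ℕ → ℤ) (L : ℕ) : Finset ℕ := (Finset.range (L + 1)).filter (Pk H L)

theorem mem_pks {H : ℕ → ℤ} {L k : ℕ} : k ∈ pks H L ↔ Pk H L k := by
  simp only [pks, Finset.mem_filter, Finset.mem_range, and_iff_right_iff_imp]
  intro h; have := h.2.1; omega

/-- Number of peaks of relative height `t`. -/
def cnt (H : ℕ → ℤ) (L t : ℕ) : ℕ := ((pks H L).filter (fun k => Ex H L k t)).card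

/-- Abstract membership. -/
def Good (ν : ℕ) (nn : Fin ν → ℕ) (H : ℕ → ℤ) (L : ℕ) : Prop :=
  VP H L ∧ (∀ k, Pk H L k → H k ≤ ν) ∧ ∀ j : Fin ν, cnt H L ((j : ℕ) + 1) = nn j

theorem VP.card_pks {H : ℕ → ℤ} {L : ℕ} (h : VP H L) (ν : ℕ) (hν : ∀ k, Pk H L k → H k ≤ ν) :
    (pks H L).card = ∑ j : Fin ν, cnt H L ((j : ℕ) + 1) := by
  have h1 : Set.MapsTo (fun k => Nat.findGreatest (RP H L k) ν) (pks H L) (Finset.Icc 1 ν) := by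
    intro k hk
    have hk' : Pk H L k := mem_pks.1 hk
    have h1 : RP H L k 1 := VP.RP_one hk'
    have h2 := h.RP_le h1
    have h3 := hν k hk'
    have := Nat.le_findGreatest (P := RP H L k) (m := 1) (n := ν) (by push_cast at h2; omega) h1
    have h4 := Nat.findGreatest_le (P := RP H L k) ν
    simp only [Finset.coe_Icc, Set.mem_Icc]
    omega
  rw [Finset.card_eq_sum_card_fiberwise h1]
  have h2 : Finset.Icc 1 ν = (Finset.range ν).image (fun j => j + 1) := by
    ext x; simp only [Finset.mem_Icc, Finset.mem_image, Finset.mem_range]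
    exact ⟨fun hx => ⟨x - 1, by omega, by omega⟩, by rintro ⟨a, h1, rfl⟩; omega⟩
  rw [h2, Finset.sum_image (by intro a _ b _ hab; simpa using hab),
    ← Fin.sum_univ_eq_sum_range (fun j => ((pks H L).filter
      (fun k => Nat.findGreatest (RP H L k) ν = j + 1)).card) ν]
  refine Finset.sum_congr rfl fun j _ => ?_
  unfold cnt
  congr 1
  refine Finset.filter_congr fun k hk => ?_
  exact h.findGreatest_iff (hν k (mem_pks.1 hk)) (by omega)

theorem Good.card {ν : ℕ} {nn : Fin ν → ℕ} {H : ℕ → ℤ} {L : ℕ} (h : Good ν nn H L) :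
    (pks H L).card = ∑ j, nn j := by
  rw [h.1.card_pks ν h.2.1]
  exact Finset.sum_congr rfl fun j _ => h.2.2 j

theorem VP.le_of_pk {H : ℕ → ℤ} {L : ℕ} (h : VP H L) {ν : ℕ} (h0 : H 0 ≤ ν)
    (hp : ∀ k, Pk H L k → H k ≤ ν) : ∀ k, k ≤ L → H k ≤ ν := by
  intro k hk
  by_contra hc
  have hk0 : k ≠ 0 := by rintro rfl; omega
  have hkL : k ≠ L := by rintro rfl; have := h.2.1; omega
  obtain ⟨m, hm1, hm2, hm3, hm4, hm5⟩ :=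
    h.exists_max (a := 0) (x := k) (b := L) (by omega) (by omega) le_rfl (by omega)
      (by rw [h.2.1]; omega)
  have := hp m hm3
  have := hm4 k (by omega) (by omega)
  omega

/-! ### Inserting `UD` factors -/

/-- `H` on `[0,L]` arises from `f` on `[0,M]` by inserting `c g` factors `UD` at vertex `g`. -/
structure Blow (f H : ℕ → ℤ) (M L : ℕ) (c p : ℕ → ℕ) : Prop where
  p0 : p 0 = 0
  ps : ∀ g, p (g + 1) = p g + 2 * c g + 1
  hL : L = p M + 2 * c M
  hH : ∀ g, g ≤ M → ∀ i, i ≤ 2 * c g → H (p g + i) = f g + ((i % 2 : ℕ) : ℤ)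
  hc : ∀ g, Pk f M g → 1 ≤ c g

namespace Blow

variable {f H : ℕ → ℤ} {M L : ℕ} {c p : ℕ → ℕ}

theorem plt (h : Blow f H M L c p) {g g' : ℕ} (hg : g < g') : p g + 2 * c g + 1 ≤ p g' := by
  induction g' with
  | zero => omega
  | succ k ih =>
    have := h.ps k
    rcases Nat.lt_or_ge g k with h1 | h1
    · have := ih h1; omega
    · have : g = k := by omega
      subst this; omega

theorem end_le (h : Blow f H M L c p) {g : ℕ} (hg : g ≤ M) : p g + 2 * c g ≤ L := by
  have := h.hL
  rcases Nat.lt_or_ge g M with h1 | h1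
  · have := h.plt h1; omega
  · have : g = M := by omega
    subst this; omega

theorem cover (h : Blow f H M L c p) {x : ℕ} (hx : x ≤ L) :
    ∃ g i, g ≤ M ∧ i ≤ 2 * c g ∧ x = p g + i := by
  have key : ∀ n, x ≤ p n + 2 * c n → ∃ g i, g ≤ n ∧ i ≤ 2 * c g ∧ x = p g + i := by
    intro n
    induction n with
    | zero => intro hx; exact ⟨0, x, le_rfl, by have := h.p0; omega, by have := h.p0; omega⟩
    | succ n ih =>
      intro hx
      rcases Nat.lt_or_ge x (p (n + 1)) with h1 | h1
      · have := h.ps n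
        obtain ⟨g, i, h2, h3, h4⟩ := ih (by omega)
        exact ⟨g, i, by omega, h3, h4⟩
      · exact ⟨n + 1, x - p (n + 1), le_rfl, by omega, by omega⟩
  exact key M (by rw [← h.hL]; exact hx)

theorem H0 (h : Blow f H M L c p) {g : ℕ} (hg : g ≤ M) : H (p g) = f g := by
  have := h.hH g hg 0 (by omega)
  simpa using this

theorem Heven (h : Blow f H M L c p) {g i : ℕ} (hg : g ≤ M) (hi : i ≤ c g) :
    H (p g + 2 * i) = f g := by
  have := h.hH g hg (2 * i) (by omega)
  simpa using this

theorem Hodd (h : Blow f H M L c p) {g i : ℕ} (hg : g ≤ M) (hi : i < c g) :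
    H (p g + 2 * i + 1) = f g + 1 := by
  have := h.hH g hg (2 * i + 1) (by omega)
  rw [show (2 * i + 1) % 2 = 1 by omega] at this
  simpa [add_assoc] using this

theorem Hge (h : Blow f H M L c p) {g i : ℕ} (hg : g ≤ M) (hi : i ≤ 2 * c g) :
    f g ≤ H (p g + i) ∧ H (p g + i) ≤ f g + 1 := by
  have := h.hH g hg i hi
  omega

theorem Hstart (h : Blow f H M L c p) : H 0 = f 0 := by
  have := h.H0 (g := 0) (by omega)
  rwa [h.p0] at this

theorem vp_iff (h : Blow f H M L c p) : VP H L ↔ VP f M := by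
  constructor
  · rintro ⟨h1, h2, h3⟩
    refine ⟨fun g hg => ?_, ?_, by rw [← h.Hstart]; exact h3⟩
    · have h4 := h.plt hg
      have h5 := h.end_le (g := M) le_rfl
      have h6 := h1 (p g + 2 * c g) (by omega)
      rw [← h.ps, h.H0 (by omega), h.Heven (by omega) le_rfl] at h6
      exact h6
    · rw [h.hL, h.Heven le_rfl le_rfl] at h2; exact h2
  · intro hf
    refine ⟨fun x hx => ?_, ?_, by rw [h.Hstart]; exact hf.2.2⟩
    · obtain ⟨g, i, hg, hi, rfl⟩ := h.cover (le_of_lt hx)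
      have hnn := hf.nonneg g hg
      rcases Nat.lt_or_ge i (2 * c g) with h1 | h1
      · have h2 := h.hH g hg i hi
        have h3 := h.hH g hg (i + 1) (by omega)
        rw [← add_assoc] at h3
        rcases Nat.mod_two_eq_zero_or_one i with h4 | h4
        · left; omega
        · right; left; omega
      · have hi' : i = 2 * c g := by omega
        subst hi'
        have hgM : g < M := by
          rcases Nat.lt_or_ge g M with h2 | h2
          · exact h2
          · have : g = M := by omega
            subst this; have := h.hL; omega
        rw [← h.ps, h.H0 (by omega), h.Heven (by omega) le_rfl]
        exact hf.1 g hgM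
    · rw [h.hL, h.Heven le_rfl le_rfl]; exact hf.2.1

theorem pk_iff (h : Blow f H M L c p) {x : ℕ} :
    Pk H L x ↔ ∃ g i, g ≤ M ∧ i < c g ∧ x = p g + 2 * i + 1 := by
  constructor
  · rintro ⟨h1, h2, h3, h4⟩
    obtain ⟨g, i, hg, hi, rfl⟩ := h.cover (le_of_lt h2)
    have h5 := h.hH g hg i hi
    rcases Nat.mod_two_eq_zero_or_one i with h6 | h6
    · exfalso
      rcases Nat.eq_zero_or_pos i with h7 | h7
      · subst h7
        have hcg : c g = 0 := by
          by_contra hc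
          have h8 := h.hH g hg 1 (by omega)
          simp only [add_zero, Nat.mod_succ] at *
          push_cast at *
          omega
        have hg0 : g ≠ 0 := by rintro rfl; have := h.p0; omega
        obtain ⟨g', rfl⟩ := Nat.exists_eq_succ_of_ne_zero hg0
        have hgM : g' + 1 < M := by
          rcases Nat.lt_or_ge (g' + 1) M with h8 | h8
          · exact h8
          · have : g' + 1 = M := by omega
            subst this; have := h.hL; simp only [Nat.succ_eq_add_one] at *; omega
        simp only [Nat.succ_eq_add_one, add_zero] at *
        have h8 := h.ps (g' + 1)
        have h9 := h.ps g'
        have h10 : p (g' + 1) - 1 = p g' + 2 * c g' := by omega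
        have h11 : p (g' + 1) + 1 = p (g' + 1 + 1) := by omega
        rw [h10, h.Heven (by omega) le_rfl, h.H0 hg] at h3
        rw [h11, h.H0 (by omega), h.H0 hg] at h4
        have := h.hc (g' + 1) ⟨by omega, hgM, by simpa using h3, h4⟩
        omega
      · have h8 := h.hH g hg (i - 1) (by omega)
        rw [show p g + (i - 1) = p g + i - 1 by omega] at h8
        omega
    · exact ⟨g, i / 2, hg, by omega, by omega⟩
  · rintro ⟨g, i, hg, hi, rfl⟩
    have h1 := h.end_le hg
    have h2 := h.Hodd hg hi
    have h3 := h.Heven hg (i := i) (by omega)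
    have h4 := h.Heven hg (i := i + 1) (by omega)
    refine ⟨by omega, by omega, ?_, ?_⟩
    · simp only [Nat.add_sub_cancel]; omega
    · rw [show p g + 2 * i + 1 + 1 = p g + 2 * (i + 1) by ring]; omega

theorem lt_of_pos_lt (h : Blow f H M L c p) {g g' i i' : ℕ} (hi : i ≤ 2 * c g)
    (hlt : p g' + i' < p g + i) : g' ≤ g := by
  by_contra hc
  have := h.plt (g := g) (g' := g') (by omega)
  omega

theorem pos_lt (h : Blow f H M L c p) {g g' i i' : ℕ} (hi : i' ≤ 2 * c g')
    (hlt : g' < g) : p g' + i' < p g + i := by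
  have := h.plt (g := g') (g' := g) (by omega)
  omega

theorem rp_up (h : Blow f H M L c p) (hf : VP f M) {g t : ℕ} (hg : Pk f M g)
    (hr : RP f M g t) : RP H L (p g + 1) (t + 1) := by
  obtain ⟨ht, k', k'', h1, h2, h3, h4, h5, h6⟩ := hr
  have hall := hf.RP_all h1 h2 h3 h4.le h5.le (by omega) h6
  have hcg := h.hc g hg
  have hgM : g ≤ M := by omega
  have hHg : H (p g + 1) = f g + 1 := by simpa using h.Hodd hgM (i := 0) (by omega)
  refine ⟨by omega, p k' + 2 * c k', p k'', ?_, ?_, ?_, ?_, ?_, ?_⟩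
  · have := h.plt h1; omega
  · have := h.plt h2; omega
  · have := h.end_le h3; omega
  · rw [h.Heven (by omega) le_rfl, hHg]; push_cast; omega
  · rw [h.H0 (by omega), hHg]; push_cast; omega
  · intro m hm1 hm2 hm
    obtain ⟨g', i, hg', hi, rfl⟩ := h.pk_iff.1 hm
    have ha : k' < g' := by
      by_contra hc
      rcases Nat.lt_or_ge g' k' with h7 | h7
      · have := h.plt h7; omega
      · have : g' = k' := by omega
        subst this; omega
    have hb : g' < k'' := by
      by_contra hc
      rcases Nat.lt_or_ge k'' g' with h7 | h7
      · have := h.plt h7; omega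
      · have : g' = k'' := by omega
        subst this; omega
    have h8 := hall g' ha hb
    rw [h.Hodd hg' hi, hHg]
    refine ⟨by omega, fun he => ?_⟩
    have h9 := h8.2 (by omega)
    rcases Nat.lt_or_ge g g' with h7 | h7
    · have := h.plt h7; omega
    · have : g = g' := by omega
      subst this; omega

/-- Window data of `H` pushed down to `f`. -/
theorem window (h : Blow f H M L c p) {g i k' k'' : ℕ} (hg : g ≤ M) (hi : i ≤ 2 * c g)
    (h1 : k' < p g + i) (h2 : p g + i < k'')
    (h3 : k'' ≤ L) (h4 : H k' < f g) (h5 : H k'' < f g) :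
    ∃ g1 g2, g1 < g ∧ g < g2 ∧ g2 ≤ M ∧ f g1 ≤ H k' ∧ f g2 ≤ H k'' ∧
      ∀ m i, g1 < m → m < g2 → i ≤ 2 * c m → k' < p m + i ∧ p m + i < k'' := by
  obtain ⟨g1, i1, hg1, hi1, rfl⟩ := h.cover (x := k') (by have := h.end_le hg; omega)
  obtain ⟨g2, i2, hg2, hi2, rfl⟩ := h.cover h3
  have a1 := h.lt_of_pos_lt hi h1
  have a2 := h.lt_of_pos_lt hi2 h2
  have a3 := (h.Hge hg1 hi1).1
  have a4 := (h.Hge hg2 hi2).1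
  have a5 : g1 ≠ g := by rintro rfl; omega
  have a6 : g2 ≠ g := by rintro rfl; omega
  exact ⟨g1, g2, by omega, by omega, hg2, a3, a4, fun m i hm1 hm2 hi =>
    ⟨h.pos_lt hi1 hm1, h.pos_lt hi hm2⟩⟩

theorem rp_down (h : Blow f H M L c p) (hf : VP f M) {g t : ℕ} (hg : Pk f M g) (ht : 0 < t)
    (hr : RP H L (p g + 1) (t + 1)) : RP f M g t := by
  obtain ⟨_, k', k'', h1, h2, h3, h4, h5, h6⟩ := hr
  have hcg := h.hc g hg
  have hgM : g ≤ M := by have := hg.2.1; omega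
  have hHg : H (p g + 1) = f g + 1 := by simpa using h.Hodd hgM (i := 0) (by omega)
  rw [hHg] at h4 h5 h6
  push_cast at h4 h5
  obtain ⟨g1, g2, b1, b2, b3, b4, b5, b6⟩ :=
    h.window hgM (i := 1) (by omega) h1 h2 h3 (by omega) (by omega)
  refine hf.RP_of_weak ht b1 b2 b3 (by omega) (by omega) ?_
  intro m hm1 hm2 hm
  have hcm := h.hc m hm
  obtain ⟨d1, d2⟩ := b6 m 1 hm1 hm2 (by omega)
  have hHm : H (p m + 1) = f m + 1 := by simpa using h.Hodd (g := m) (by omega) (i := 0) (by omega)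
  have h7 := h6 (p m + 1) d1 d2 (h.pk_iff.2 ⟨m, 0, by omega, by omega, by ring⟩)
  rw [hHm] at h7
  refine ⟨by omega, fun he => ?_⟩
  have h8 := h7.2 (by omega)
  by_contra hc
  have := h.plt (g := m) (g' := g) (by omega)
  omega

theorem rp_other (h : Blow f H M L c p) (hf : VP f M) {g i t : ℕ} (hg : g ≤ M) (hi : i < c g)
    (hno : ¬ (Pk f M g ∧ i = 0)) (ht : 2 ≤ t) : ¬ RP H L (p g + 2 * i + 1) t := by
  rintro ⟨_, k', k'', h1, h2, h3, h4, h5, h6⟩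
  have hH := h.Hodd hg hi
  rw [hH] at h4 h5 h6
  have hVH := h.vp_iff.2 hf
  by_cases hi0 : i = 0
  · subst hi0
    have hnp : ¬ Pk f M g := fun hh => hno ⟨hh, rfl⟩
    obtain ⟨g1, g2, b1, b2, b3, b4, b5, b6⟩ :=
      h.window hg (i := 1) (by omega) h1 h2 h3 (by omega) (by omega)
    have hpk : ∀ m, g1 < m → m < g2 → Pk f M m → f m ≤ f g := by
      intro m hm1 hm2 hm
      have hcm := h.hc m hm
      obtain ⟨d1, d2⟩ := b6 m 1 hm1 hm2 (by omega)
      have hHm : H (p m + 1) = f m + 1 := by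
        simpa using h.Hodd (g := m) (by omega) (i := 0) (by omega)
      have h7 := h6 (p m + 1) d1 d2 (h.pk_iff.2 ⟨m, 0, by omega, by omega, by ring⟩)
      omega
    have n1 := hf.nonneg g1 (by omega)
    have n2 := hf.nonneg (g - 1) (by omega)
    have s1 := hf.1 (g - 1) (by omega)
    rw [Nat.sub_add_cancel (by omega)] at s1
    have s2 := hf.1 g (by omega)
    rcases s1 with s1 | s1 | s1
    · rcases s2 with s2 | s2 | s2
      · have : g + 1 ≠ g2 := by rintro rfl; omega
        obtain ⟨m, c1, c2, c3, c4, c5⟩ := hf.exists_max (a := g) (x := g + 1) (b := g2)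
          (by omega) (by omega) b3 (by omega) (by omega)
        have := hpk m (by omega) c2 c3
        have := c4 (g + 1) (by omega) (by omega)
        omega
      · exact hnp ⟨by omega, by omega, by omega, by omega⟩
      · omega
    · have : g1 ≠ g - 1 := by rintro rfl; omega
      obtain ⟨m, c1, c2, c3, c4, c5⟩ := hf.exists_max (a := g1) (x := g - 1) (b := g)
          (by omega) (by omega) hg (by omega) (by omega)
      have := hpk m (by omega) (by omega) c3
      have := c4 (g - 1) (by omega) (by omega)
      omega
    · omega
  · obtain ⟨j, rfl⟩ := Nat.exists_eq_succ_of_ne_zero hi0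
    simp only [Nat.succ_eq_add_one] at *
    have e1 := h.Hodd hg (i := j) (by omega)
    have e2 := h.Heven hg (i := j + 1) (by omega)
    have k1 : k' ≠ p g + 2 * j + 1 := by rintro rfl; omega
    have k2 : k' ≠ p g + 2 * (j + 1) := by rintro rfl; omega
    have h7 := h6 (p g + 2 * j + 1) (by omega) (by omega)
      (h.pk_iff.2 ⟨g, j, hg, by omega, rfl⟩)
    have := h7.2 (by omega)
    omega

theorem cnt_eq (h : Blow f H M L c p) (hf : VP f M) {t : ℕ} (ht : 0 < t) :
    cnt H L (t + 1) = cnt f M t := by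
  symm
  unfold cnt
  have hiff : ∀ g, Pk f M g → (Ex f M g t ↔ Ex H L (p g + 1) (t + 1)) := by
    intro g hg
    unfold Ex
    exact and_congr ⟨h.rp_up hf hg, h.rp_down hf hg ht⟩
      (not_congr ⟨h.rp_up hf hg, h.rp_down hf hg (by omega)⟩)
  refine Finset.card_bij (fun g _ => p g + 1) ?_ ?_ ?_
  · intro g hg
    rw [Finset.mem_filter, mem_pks] at hg ⊢
    refine ⟨h.pk_iff.2 ⟨g, 0, ?_, ?_, by ring⟩, (hiff g hg.1).1 hg.2⟩
    · have := hg.1.2.1; omega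
    · have := h.hc g hg.1; omega
  · intro a _ b _ hab
    rcases lt_trichotomy a b with h1 | h1 | h1
    · have := h.plt h1; omega
    · exact h1
    · have := h.plt h1; omega
  · intro x hx
    rw [Finset.mem_filter, mem_pks] at hx
    obtain ⟨g, i, hg, hi, rfl⟩ := h.pk_iff.1 hx.1
    by_cases hno : Pk f M g ∧ i = 0
    · obtain ⟨hp, rfl⟩ := hno
      refine ⟨g, ?_, by ring⟩
      rw [Finset.mem_filter, mem_pks]
      exact ⟨hp, (hiff g hp).2 (by simpa using hx.2)⟩
    · exact absurd hx.2.1 (h.rp_other hf hg hi hno (by omega))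

theorem sum_pks (h : Blow f H M L c p) {α : Type*} [AddCommMonoid α] (F : ℕ → α) :
    ∑ x ∈ pks H L, F x
      = ∑ g ∈ Finset.range (M + 1), ∑ i ∈ Finset.range (c g), F (p g + 2 * i + 1) := by
  rw [Finset.sum_sigma']
  symm
  refine Finset.sum_bij (fun x _ => p x.1 + 2 * x.2 + 1) ?_ ?_ ?_ ?_
  · rintro ⟨g, i⟩ hx
    simp only [Finset.mem_sigma, Finset.mem_range] at hx
    rw [mem_pks]
    exact h.pk_iff.2 ⟨g, i, by omega, hx.2, rfl⟩
  · rintro ⟨a, i⟩ hx ⟨b, j⟩ hy hab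
    simp only [Finset.mem_sigma, Finset.mem_range] at hx hy hab
    rcases lt_trichotomy a b with h1 | h1 | h1
    · have := h.plt h1; omega
    · subst h1
      have : i = j := by omega
      rw [this]
    · have := h.plt h1; omega
  · intro x hx
    obtain ⟨g, i, hg, hi, rfl⟩ := h.pk_iff.1 (mem_pks.1 hx)
    exact ⟨⟨g, i⟩, by simp only [Finset.mem_sigma, Finset.mem_range]; omega, rfl⟩
  · intro _ _; rfl

theorem card_pks (h : Blow f H M L c p) :
    (pks H L).card = ∑ g ∈ Finset.range (M + 1), c g := by
  have := h.sum_pks (fun _ => 1)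
  simpa using this

theorem p_eq (h : Blow f H M L c p) (g : ℕ) : p g = g + 2 * ∑ i ∈ Finset.range g, c i := by
  induction g with
  | zero => simp [h.p0]
  | succ g ih => rw [h.ps, ih, Finset.sum_range_succ]; ring

theorem L_eq (h : Blow f H M L c p) : L = M + 2 * ∑ g ∈ Finset.range (M + 1), c g := by
  rw [h.hL, h.p_eq, Finset.sum_range_succ]; ring

theorem weight (h : Blow f H M L c p) :
    ∑ x ∈ pks H L, x = (∑ g ∈ Finset.range (M + 1), c g) ^ 2 +
      ∑ g ∈ Finset.range (M + 1), g * c g := by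
  rw [h.sum_pks (fun x => x)]
  have h1 : ∀ P n : ℕ, ∑ i ∈ Finset.range n, (P + 2 * i + 1) = n * P + n ^ 2 := by
    intro P n
    induction n with
    | zero => simp
    | succ n ih => rw [Finset.sum_range_succ, ih]; ring
  simp only [h1, h.p_eq]
  generalize M + 1 = n
  induction n with
  | zero => simp
  | succ n ih => rw [Finset.sum_range_succ, ih, Finset.sum_range_succ, Finset.sum_range_succ]; ring

theorem good_iff (h : Blow f H M L c p) {ν : ℕ} (nn : Fin (ν + 1) → ℕ) (h0 : f 0 ≤ ν) :
    Good (ν + 1) nn H L ↔ (Good ν (fun j => nn j.succ) f M ∧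
      ∑ g ∈ Finset.range (M + 1), c g = ∑ j, nn j) := by
  constructor
  · intro hG
    have hf := h.vp_iff.1 hG.1
    refine ⟨⟨hf, ?_, ?_⟩, ?_⟩
    · intro g hg
      have hcg := h.hc g hg
      have hgM : g ≤ M := by have := hg.2.1; omega
      have h1 := hG.2.1 _ (h.pk_iff.2 ⟨g, 0, hgM, by omega, rfl⟩)
      rw [h.Hodd hgM (i := 0) (by omega)] at h1
      push_cast at h1; omega
    · intro j
      have := hG.2.2 j.succ
      rw [Fin.val_succ, h.cnt_eq hf (by omega)] at this
      exact this
    · rw [← h.card_pks]; exact hG.card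
  · rintro ⟨hf, hs⟩
    have hV := h.vp_iff.2 hf.1
    have hle : ∀ k, Pk H L k → H k ≤ ((ν + 1 : ℕ) : ℤ) := by
      intro x hx
      obtain ⟨g, i, hg, hi, rfl⟩ := h.pk_iff.1 hx
      rw [h.Hodd hg hi]
      have := hf.1.le_of_pk h0 hf.2.1 g hg
      push_cast; omega
    have hsucc : ∀ j : Fin ν, cnt H L ((j.succ : ℕ) + 1) = nn j.succ := by
      intro j
      rw [Fin.val_succ, h.cnt_eq hf.1 (by omega)]
      exact hf.2.2 j
    refine ⟨hV, hle, ?_⟩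
    have h1 := hV.card_pks (ν + 1) hle
    rw [h.card_pks, hs, Fin.sum_univ_succ, Fin.sum_univ_succ,
      Finset.sum_congr rfl (fun j _ => hsucc j)] at h1
    intro j
    refine Fin.cases ?_ hsucc j
    omega

end Blow

/-! ### Prepending a `D` step -/

section Shift

variable {f H : ℕ → ℤ} {L : ℕ}

theorem sh_pk (h1 : ∀ k, H (k + 1) = f k) (h0 : H 0 = f 0 + 1) {x : ℕ} :
    Pk H (L + 1) x ↔ ∃ k, x = k + 1 ∧ Pk f L k := by
  constructor
  · rintro ⟨a1, a2, a3, a4⟩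
    obtain ⟨k, rfl⟩ := Nat.exists_eq_succ_of_ne_zero (show x ≠ 0 by omega)
    simp only [Nat.succ_eq_add_one, Nat.add_sub_cancel] at *
    rw [h1] at a3 a4
    rw [h1] at a4
    have hk : k ≠ 0 := by rintro rfl; omega
    obtain ⟨j, rfl⟩ := Nat.exists_eq_succ_of_ne_zero hk
    simp only [Nat.succ_eq_add_one] at *
    rw [h1] at a3
    exact ⟨j + 1, rfl, by omega, by omega, by simpa using a3, a4⟩
  · rintro ⟨k, rfl, a1, a2, a3, a4⟩
    obtain ⟨j, rfl⟩ := Nat.exists_eq_succ_of_ne_zero (show k ≠ 0 by omega)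
    simp only [Nat.succ_eq_add_one, Nat.add_sub_cancel] at *
    refine ⟨by omega, by omega, ?_, ?_⟩
    · simp only [Nat.add_sub_cancel]; rw [h1, h1]; exact a3
    · rw [h1, h1]; exact a4

theorem sh_rp (h1 : ∀ k, H (k + 1) = f k) (h0 : H 0 = f 0 + 1) (hf : VP f L) {k t : ℕ}
    (hk : Pk f L k) : RP H (L + 1) (k + 1) t ↔ RP f L k t := by
  constructor
  · rintro ⟨ht, k', k'', a1, a2, a3, a4, a5, a6⟩
    rw [h1] at a4 a5 a6
    obtain ⟨j, rfl⟩ := Nat.exists_eq_succ_of_ne_zero (show k'' ≠ 0 by omega)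
    simp only [Nat.succ_eq_add_one] at *
    rw [h1] at a5
    refine hf.RP_of_weak (k' := k' - 1) ht (by have := hk.1; omega) (show k < j by omega)
      (by omega) ?_ (by omega) ?_
    · rcases Nat.eq_zero_or_pos k' with h | h
      · subst h; simp; omega
      · have := h1 (k' - 1)
        rw [Nat.sub_add_cancel h] at this
        omega
    · intro m hm1 hm2 hm
      have := a6 (m + 1) (by omega) (by omega) ((sh_pk h1 h0).2 ⟨m, rfl, hm⟩)
      rw [h1] at this
      exact ⟨this.1, fun he => by have := this.2 he; omega⟩
  · rintro ⟨ht, k', k'', a1, a2, a3, a4, a5, a6⟩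
    refine ⟨ht, k' + 1, k'' + 1, by omega, by omega, by omega, ?_, ?_, ?_⟩
    · rw [h1, h1]; exact a4
    · rw [h1, h1]; exact a5
    · intro m hm1 hm2 hm
      obtain ⟨j, rfl, hj⟩ := (sh_pk h1 h0).1 hm
      rw [h1, h1]
      have := a6 j (by omega) (by omega) hj
      exact ⟨this.1, fun he => by have := this.2 he; omega⟩

theorem sh_pks (h1 : ∀ k, H (k + 1) = f k) (h0 : H 0 = f 0 + 1) :
    pks H (L + 1) = (pks f L).image (fun k => k + 1) := by
  ext x
  rw [mem_pks, Finset.mem_image, sh_pk h1 h0]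
  constructor
  · rintro ⟨k, rfl, hk⟩; exact ⟨k, mem_pks.2 hk, rfl⟩
  · rintro ⟨k, hk, rfl⟩; exact ⟨k, rfl, mem_pks.1 hk⟩

theorem sh_cnt (h1 : ∀ k, H (k + 1) = f k) (h0 : H 0 = f 0 + 1) (hf : VP f L) (t : ℕ) :
    cnt H (L + 1) t = cnt f L t := by
  symm
  unfold cnt
  have hex : ∀ k, Pk f L k → (Ex H (L + 1) (k + 1) t ↔ Ex f L k t) := fun k hk =>
    and_congr (sh_rp h1 h0 hf hk) (not_congr (sh_rp h1 h0 hf hk))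
  refine Finset.card_bij (fun k _ => k + 1) ?_ ?_ ?_
  · intro k hk
    rw [Finset.mem_filter, mem_pks] at hk ⊢
    exact ⟨(sh_pk h1 h0).2 ⟨k, rfl, hk.1⟩, (hex k hk.1).2 hk.2⟩
  · intro a _ b _ hab; simpa using hab
  · intro x hx
    rw [Finset.mem_filter, mem_pks] at hx
    obtain ⟨k, rfl, hk⟩ := (sh_pk h1 h0).1 hx.1
    refine ⟨k, ?_, rfl⟩
    rw [Finset.mem_filter, mem_pks]
    exact ⟨hk, (hex k hk).1 hx.2⟩

theorem sh_good (h1 : ∀ k, H (k + 1) = f k) (h0 : H 0 = f 0 + 1) (hf0 : 0 ≤ f 0) {ν : ℕ}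
    (nn : Fin ν → ℕ) : Good ν nn H (L + 1) ↔ Good ν nn f L := by
  have hV : VP H (L + 1) ↔ VP f L := by
    constructor
    · rintro ⟨a1, a2, a3⟩
      refine ⟨fun k hk => ?_, by rw [← h1]; exact a2, hf0⟩
      have := a1 (k + 1) (by omega)
      rwa [h1, h1] at this
    · rintro ⟨a1, a2, a3⟩
      refine ⟨fun k hk => ?_, by rw [h1]; exact a2, by omega⟩
      rcases Nat.eq_zero_or_pos k with h | h
      · subst h
        right; left
        have := h1 0
        omega
      · obtain ⟨j, rfl⟩ := Nat.exists_eq_succ_of_ne_zero (show k ≠ 0 by omega)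
        simp only [Nat.succ_eq_add_one] at *
        rw [h1, h1]
        exact a1 j (by omega)
  have hP : (∀ k, Pk H (L + 1) k → H k ≤ ν) ↔ (∀ k, Pk f L k → f k ≤ ν) := by
    constructor
    · intro h k hk
      have := h (k + 1) ((sh_pk h1 h0).2 ⟨k, rfl, hk⟩)
      rwa [h1] at this
    · intro h x hx
      obtain ⟨k, rfl, hk⟩ := (sh_pk h1 h0).1 hx
      rw [h1]; exact h k hk
  unfold Good
  constructor
  · rintro ⟨a1, a2, a3⟩
    have hf := hV.1 a1
    exact ⟨hf, hP.1 a2, fun j => by rw [← sh_cnt h1 h0 hf]; exact a3 j⟩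
  · rintro ⟨hf, a2, a3⟩
    exact ⟨hV.2 hf, hP.2 a2, fun j => by rw [sh_cnt h1 h0 hf]; exact a3 j⟩

/-- Total weight. -/
def wt (H : ℕ → ℤ) (L : ℕ) : ℕ := ∑ x ∈ pks H L, x

theorem sh_wt (h1 : ∀ k, H (k + 1) = f k) (h0 : H 0 = f 0 + 1) :
    wt H (L + 1) = wt f L + (pks f L).card := by
  unfold wt
  rw [sh_pks h1 h0, Finset.sum_image (by intro a _ b _ hab; simpa using hab),
    Finset.sum_add_distrib]
  simp

end Shift

/-! ### Words -/

/-- Heights along a word. -/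
def Hl : ℤ → List (Fin 3) → ℕ → ℤ
  | y, [], _ => y
  | y, _ :: _, 0 => y
  | y, a :: w, (k + 1) => Hl (y + stepVal a) w k

@[simp] theorem Hl_zero (y : ℤ) (w : List (Fin 3)) : Hl y w 0 = y := by
  cases w <;> rfl

@[simp] theorem Hl_cons (y : ℤ) (a : Fin 3) (w : List (Fin 3)) (k : ℕ) :
    Hl y (a :: w) (k + 1) = Hl (y + stepVal a) w k := rfl

theorem Hl_step (w : List (Fin 3)) : ∀ (y : ℤ) (k : ℕ) (hk : k < w.length),
    Hl y w (k + 1) = Hl y w k + stepVal (w[k]) := by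
  induction w with
  | nil => intro y k hk; simp at hk
  | cons a w ih =>
    intro y k hk
    cases k with
    | zero => simp
    | succ k => simpa using ih (y + stepVal a) k (by simpa using hk)

theorem stepVal_eq_one {a : Fin 3} : stepVal a = 1 ↔ a = 0 := by
  fin_cases a <;> simp [stepVal]

theorem stepVal_eq_neg {a : Fin 3} : stepVal a = -1 ↔ a = 1 := by
  fin_cases a <;> simp [stepVal]

theorem stepVal_eq_zero {a : Fin 3} : stepVal a = 0 ↔ a = 2 := by
  fin_cases a <;> simp [stepVal]

theorem pk_Hl {y : ℤ} {w : List (Fin 3)} {k : ℕ} : Pk (Hl y w) w.length (k + 1) ↔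
    (w[k]? = some 0 ∧ w[k + 1]? = some 1) := by
  constructor
  · rintro ⟨h1, h2, h3, h4⟩
    simp only [Nat.add_sub_cancel] at h3
    have a1 := Hl_step w y k (by omega)
    have a2 := Hl_step w y (k + 1) h2
    rw [List.getElem?_eq_getElem (by omega), List.getElem?_eq_getElem h2]
    exact ⟨congrArg some (stepVal_eq_one.1 (by omega)),
      congrArg some (stepVal_eq_neg.1 (by omega))⟩
  · rintro ⟨h1, h2⟩
    obtain ⟨b1, c1⟩ := List.getElem?_eq_some_iff.1 h1
    obtain ⟨b2, c2⟩ := List.getElem?_eq_some_iff.1 h2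
    have a1 := Hl_step w y k (by omega)
    have a2 := Hl_step w y (k + 1) b2
    rw [c1, stepVal_eq_one.2 rfl] at a1
    rw [c2, stepVal_eq_neg.2 rfl] at a2
    exact ⟨by omega, b2, by simp only [Nat.add_sub_cancel]; omega, by omega⟩

/-- Prepend `n` copies of `UD`. -/
def ud : ℕ → List (Fin 3) → List (Fin 3)
  | 0, r => r
  | (n + 1), r => 0 :: 1 :: ud n r

/-- Insert `c g` copies of `UD` at vertex `g`. -/
def ins : (ℕ → ℕ) → List (Fin 3) → List (Fin 3)
  | c, [] => ud (c 0) []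
  | c, a :: w => ud (c 0) (a :: ins (fun g => c (g + 1)) w)

theorem length_ud (n : ℕ) (r : List (Fin 3)) : (ud n r).length = r.length + 2 * n := by
  induction n with
  | zero => rfl
  | succ n ih => simp only [ud, List.length_cons, ih]; ring

theorem Hl_ud (n : ℕ) (r : List (Fin 3)) (y : ℤ) (k : ℕ) :
    Hl y (ud n r) (2 * n + k) = Hl y r k := by
  induction n with
  | zero => simp [ud]
  | succ n ih =>
    rw [show 2 * (n + 1) + k = (2 * n + k + 1) + 1 by ring]
    simp only [ud, Hl_cons]
    rw [← ih]; simp [stepVal]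

theorem Hl_ud' (n : ℕ) (r : List (Fin 3)) (y : ℤ) (i : ℕ) (hi : i ≤ 2 * n) :
    Hl y (ud n r) i = y + ((i % 2 : ℕ) : ℤ) := by
  induction n generalizing i with
  | zero => have : i = 0 := by omega
            subst this; simp
  | succ n ih =>
    match i with
    | 0 => simp
    | 1 => simp [ud, stepVal]
    | (j + 2) =>
      simp only [ud, Hl_cons]
      have := ih j (by omega)
      simp [stepVal] at this ⊢
      omega

/-- Position of block `g`. -/
def pos (c : ℕ → ℕ) (g : ℕ) : ℕ := g + 2 * ∑ i ∈ Finset.range g, c i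

theorem pos_succ (c : ℕ → ℕ) (g : ℕ) : pos c (g + 1) = pos c g + 2 * c g + 1 := by
  simp only [pos, Finset.sum_range_succ]; ring

theorem pos_succ' (c : ℕ → ℕ) (g : ℕ) :
    pos c (g + 1) = 2 * c 0 + (pos (fun g => c (g + 1)) g + 1) := by
  simp only [pos, Finset.sum_range_succ']; ring

theorem Hl_ins (w : List (Fin 3)) : ∀ (c : ℕ → ℕ) (y : ℤ) (g : ℕ), g ≤ w.length →
    ∀ i, i ≤ 2 * c g → Hl y (ins c w) (pos c g + i) = Hl y w g + ((i % 2 : ℕ) : ℤ) := by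
  induction w with
  | nil =>
    intro c y g hg i hi
    have : g = 0 := by simpa using hg
    subst this
    simp only [ins, Hl_zero, pos, Finset.range_zero, Finset.sum_empty, mul_zero, zero_add]
    exact Hl_ud' _ _ _ _ hi
  | cons a w ih =>
    intro c y g hg i hi
    cases g with
    | zero =>
      simp only [ins, Hl_zero, pos, Finset.range_zero, Finset.sum_empty, mul_zero, zero_add]
      exact Hl_ud' _ _ _ _ hi
    | succ g =>
      rw [pos_succ', add_assoc, ins, Hl_ud, add_right_comm, Hl_cons, Hl_cons]
      exact ih _ _ g (by simpa using hg) i hi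

theorem length_ins (w : List (Fin 3)) : ∀ c : ℕ → ℕ,
    (ins c w).length = pos c w.length + 2 * c w.length := by
  induction w with
  | nil => intro c; simp [ins, length_ud, pos]
  | cons a w ih =>
    intro c
    rw [ins, length_ud, List.length_cons, ih, List.length_cons, pos_succ']; ring

/-- Every `UD` of `w` receives an insertion. -/
def PC (c : ℕ → ℕ) (w : List (Fin 3)) : Prop :=
  ∀ g, w[g]? = some 0 → w[g + 1]? = some 1 → 1 ≤ c (g + 1)

theorem blow_ins (c : ℕ → ℕ) (w : List (Fin 3)) (y : ℤ) (h : PC c w) :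
    Blow (Hl y w) (Hl y (ins c w)) w.length (ins c w).length c (pos c) where
  p0 := by simp [pos]
  ps := pos_succ c
  hL := length_ins w c
  hH := Hl_ins w c y
  hc := by
    intro g hg
    obtain ⟨k, rfl⟩ := Nat.exists_eq_succ_of_ne_zero (show g ≠ 0 by have := hg.1; omega)
    obtain ⟨h1, h2⟩ := pk_Hl.1 hg
    exact h k h1 h2

theorem ins_succ (c : ℕ → ℕ) (w : List (Fin 3)) (n : ℕ) (h : c 0 = n + 1) :
    ins c w = 0 :: 1 :: ins (Function.update c 0 n) w := by
  cases w with
  | nil => simp [ins, h, ud]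
  | cons a w => simp [ins, h, ud]

theorem ins_nil (c : ℕ → ℕ) (h : c 0 = 0) : ins c [] = [] := by simp [ins, h, ud]

theorem ins_cons (c : ℕ → ℕ) (a : Fin 3) (w : List (Fin 3)) (h : c 0 = 0) :
    ins c (a :: w) = a :: ins (fun g => c (g + 1)) w := by simp [ins, h, ud]

theorem PC_tail {c : ℕ → ℕ} {a : Fin 3} {w : List (Fin 3)} (h : PC c (a :: w)) :
    PC (fun g => c (g + 1)) w := by
  intro g h1 h2
  exact h (g + 1) (by simpa using h1) (by simpa using h2)

theorem ins_head_one {c : ℕ → ℕ} {w r : List (Fin 3)} (h : ins c w = 1 :: r) :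
    c 0 = 0 ∧ ∃ w', w = 1 :: w' := by
  have h0 : c 0 = 0 := by
    by_contra hc
    obtain ⟨n, hn⟩ := Nat.exists_eq_succ_of_ne_zero hc
    rw [ins_succ c w n hn] at h
    simp at h
  refine ⟨h0, ?_⟩
  cases w with
  | nil => rw [ins_nil c h0] at h; simp at h
  | cons a w => rw [ins_cons c a w h0] at h; simp at h; exact ⟨w, by rw [h.1]⟩

theorem ins_ne {c : ℕ → ℕ} {w r : List (Fin 3)} (hp : PC c w) (h0 : c 0 = 0) :
    ins c w ≠ 0 :: 1 :: r := by
  intro h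
  cases w with
  | nil => rw [ins_nil c h0] at h; simp at h
  | cons a w =>
    rw [ins_cons c a w h0] at h
    simp only [List.cons.injEq] at h
    obtain ⟨rfl, h⟩ := h
    obtain ⟨h1, w', rfl⟩ := ins_head_one h
    have := hp 0 (by simp) (by simp)
    simp at h1 this; omega

theorem ins_inj (n : ℕ) : ∀ (c c2 : ℕ → ℕ) (w w2 : List (Fin 3)), (ins c w).length ≤ n →
    PC c w → PC c2 w2 → ins c w = ins c2 w2 → w = w2 ∧ ∀ g, g ≤ w.length → c g = c2 g := by
  induction n with
  | zero =>
    intro c c2 w w2 hn _ _ he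
    have l1 := length_ins w c
    have l2 := length_ins w2 c2
    rw [← he] at l2
    simp only [pos] at l1 l2
    have e1 : w = [] := List.length_eq_zero_iff.1 (by omega)
    have e2 : w2 = [] := List.length_eq_zero_iff.1 (by omega)
    subst e1; subst e2
    refine ⟨rfl, fun g hg => ?_⟩
    have : g = 0 := by simpa using hg
    subst this
    simp at l1 l2; omega
  | succ n ih =>
    intro c c2 w w2 hn hp hp2 he
    rcases Nat.eq_zero_or_pos (c 0) with h0 | h0 <;> rcases Nat.eq_zero_or_pos (c2 0) with h02 | h02
    · cases w with
      | nil =>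
        rw [ins_nil c h0] at he
        cases w2 with
        | nil =>
          refine ⟨rfl, fun g hg => ?_⟩
          have : g = 0 := by simpa using hg
          subst this; omega
        | cons b w2 => rw [ins_cons c2 b w2 h02] at he; simp at he
      | cons a w =>
        rw [ins_cons c a w h0] at he hn
        cases w2 with
        | nil => rw [ins_nil c2 h02] at he; simp at he
        | cons b w2 =>
          rw [ins_cons c2 b w2 h02] at he
          simp only [List.cons.injEq] at he
          obtain ⟨rfl, he⟩ := he
          obtain ⟨h1, h2⟩ := ih _ _ w w2 (by simpa using hn) (PC_tail hp) (PC_tail hp2) he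
          refine ⟨by rw [h1], fun g hg => ?_⟩
          cases g with
          | zero => omega
          | succ g => exact h2 g (by simpa using hg)
    · obtain ⟨m, hm⟩ := Nat.exists_eq_succ_of_ne_zero (show c2 0 ≠ 0 by omega)
      rw [ins_succ c2 w2 m hm] at he
      exact absurd he (ins_ne hp h0)
    · obtain ⟨m, hm⟩ := Nat.exists_eq_succ_of_ne_zero (show c 0 ≠ 0 by omega)
      rw [ins_succ c w m hm] at he
      exact absurd he.symm (ins_ne hp2 h02)
    · obtain ⟨m, hm⟩ := Nat.exists_eq_succ_of_ne_zero (show c 0 ≠ 0 by omega)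
      obtain ⟨m2, hm2⟩ := Nat.exists_eq_succ_of_ne_zero (show c2 0 ≠ 0 by omega)
      rw [ins_succ c w m hm] at he hn
      rw [ins_succ c2 w2 m2 hm2] at he
      simp only [List.cons.injEq, true_and] at he
      simp only [List.length_cons] at hn
      obtain ⟨h1, h2⟩ := ih _ _ w w2 (by omega)
        (fun g a b => by simpa using hp g a b) (fun g a b => by simpa using hp2 g a b) he
      refine ⟨h1, fun g hg => ?_⟩
      have := h2 g hg
      cases g with
      | zero => simp at this; omega
      | succ g => simpa using this

theorem ins_surj (n : ℕ) : ∀ r : List (Fin 3), r.length ≤ n → ∃ c w, PC c w ∧ ins c w = r := by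
  induction n with
  | zero =>
    intro r hr
    have : r = [] := List.length_eq_zero_iff.1 (by omega)
    subst this
    exact ⟨fun _ => 0, [], by intro g h; simp at h, ins_nil _ rfl⟩
  | succ n ih =>
    intro r hr
    by_cases hud : ∃ r', r = 0 :: 1 :: r'
    · obtain ⟨r', rfl⟩ := hud
      obtain ⟨c, w, h1, h2⟩ := ih r' (by simp at hr; omega)
      refine ⟨Function.update c 0 (c 0 + 1), w, fun g a b => by simpa using h1 g a b, ?_⟩
      rw [ins_succ _ w (c 0) (by simp)]
      simp [h2]
    · cases r with
      | nil => exact ⟨fun _ => 0, [], by intro g h; simp at h, ins_nil _ rfl⟩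
      | cons a r =>
        obtain ⟨c, w, h1, h2⟩ := ih r (by simpa using hr)
        refine ⟨fun g => if g = 0 then 0 else c (g - 1), a :: w, ?_, ?_⟩
        · intro g a1 a2
          simp only [Nat.add_eq_zero_iff, one_ne_zero, and_false, if_false, Nat.add_sub_cancel]
          cases g with
          | zero =>
            by_contra hc
            have hc0 : c 0 = 0 := by omega
            simp at a1 a2
            cases w with
            | nil => simp at a2
            | cons b w =>
              simp at a2
              rw [ins_cons c b w hc0, a2] at h2
              exact hud ⟨_, by rw [a1, ← h2]⟩
          | succ g => exact h1 g (by simpa using a1) (by simpa using a2)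
        · rw [ins_cons _ a w (by simp)]
          simp [h2]

/-! ### Generating functions -/

/-- All words of length `L`. -/
def lsts (L : ℕ) : Finset (List (Fin 3)) :=
  Finset.univ.image (fun d : Fin L → Fin 3 => List.ofFn d)

theorem mem_lsts {L : ℕ} {w : List (Fin 3)} : w ∈ lsts L ↔ w.length = L := by
  simp only [lsts, Finset.mem_image, Finset.mem_univ, true_and]
  constructor
  · rintro ⟨d, rfl⟩; simp
  · rintro rfl; exact ⟨w.get, List.ofFn_get w⟩

/-- Weighted count of words. -/
def AA (q : ℂ) (ν : ℕ) (nn : Fin ν → ℕ) (y : ℤ) (L : ℕ) : ℂ :=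
  ∑ w ∈ (lsts L).filter (fun w => Good ν nn (Hl y w) L), q ^ wt (Hl y w) L

/-- Complete homogeneous sum. -/
def hsum (q : ℂ) (k n : ℕ) : ℂ :=
  ∑ c ∈ Finset.Nat.antidiagonalTuple k n, q ^ (∑ i : Fin k, (i : ℕ) * c i)

/-- Insertion numbers from the free parameters. -/
def cc (y : ℤ) (M : ℕ) (w : List (Fin 3)) (c : Fin (M + 1) → ℕ) (g : ℕ) : ℕ :=
  (if h : g < M + 1 then c ⟨g, h⟩ else 0) + if Pk (Hl y w) M g then 1 else 0

theorem cc_sum (y : ℤ) (M : ℕ) (w : List (Fin 3)) (c : Fin (M + 1) → ℕ) (F : ℕ → ℕ) :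
    ∑ g ∈ Finset.range (M + 1), F g * cc y M w c g =
      (∑ i : Fin (M + 1), F i * c i) + ∑ g ∈ pks (Hl y w) M, F g := by
  simp only [cc, mul_add, Finset.sum_add_distrib]
  congr 1
  · rw [← Fin.sum_univ_eq_sum_range (fun g => F g * if h : g < M + 1 then c ⟨g, h⟩ else 0)]
    refine Finset.sum_congr rfl fun i _ => ?_
    rw [dif_pos i.2]
  · rw [pks, Finset.sum_filter]
    refine Finset.sum_congr rfl fun i _ => ?_
    split_ifs <;> simp

theorem cc_PC (y : ℤ) (w : List (Fin 3)) (c : Fin (w.length + 1) → ℕ) :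
    PC (cc y w.length w c) w := by
  intro g h1 h2
  have : Pk (Hl y w) w.length (g + 1) := pk_Hl.2 ⟨h1, h2⟩
  simp only [cc, if_pos this]
  omega

theorem AA_rec (q : ℂ) (ν : ℕ) (nn : Fin (ν + 1) → ℕ) (y : ℤ) (hy : y ≤ ν) (M : ℕ) :
    AA q (ν + 1) nn y (M + 2 * ∑ j, nn j) =
      q ^ ((∑ j, nn j) ^ 2) * (AA q ν (fun j => nn j.succ) y M * hsum q (M + 1) (nn 0)) := by
  unfold AA hsum
  rw [Finset.sum_mul_sum, ← Finset.sum_product']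
  symm
  refine (Finset.mul_sum _ _ _).trans ?_
  refine Finset.sum_bij (fun (x : List (Fin 3) × (Fin (M + 1) → ℕ)) _ => ins (cc y M x.1 x.2) x.1) ?_ ?_ ?_ ?_
  · rintro ⟨w, c⟩ hx
    simp only [Finset.mem_product, Finset.mem_filter, mem_lsts,
      Finset.Nat.mem_antidiagonalTuple] at hx ⊢
    obtain ⟨⟨rfl, hg⟩, hc⟩ := hx
    have hb := blow_ins _ w y (cc_PC y w c)
    have hs := cc_sum y w.length w c (fun _ => 1)
    simp only [one_mul, Finset.sum_const, smul_eq_mul, mul_one] at hs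
    rw [hc, hg.card, ← Fin.sum_univ_succ] at hs
    have hl := hb.L_eq
    rw [hs] at hl
    refine ⟨hl, ?_⟩
    rw [← hl]
    exact (hb.good_iff nn (by simpa using hy)).2 ⟨hg, hs⟩
  · rintro ⟨w, c⟩ hx ⟨w2, c2⟩ hx2 he
    simp only [Finset.mem_product, Finset.mem_filter, mem_lsts] at hx hx2 he
    obtain ⟨⟨rfl, hg⟩, hc⟩ := hx
    obtain ⟨⟨hl2, hg2⟩, hc2⟩ := hx2
    have hp2 : PC (cc y w.length w2 c2) w2 := by
      have := cc_PC y w2 (fun i => c2 (Fin.cast (by rw [hl2]) i))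
      intro g h1 h2
      have : Pk (Hl y w2) w.length (g + 1) := by rw [← hl2]; exact pk_Hl.2 ⟨h1, h2⟩
      simp only [cc, if_pos this]
      omega
    obtain ⟨h1, h2⟩ := ins_inj _ _ _ w w2 le_rfl (cc_PC y w c) hp2 he
    subst h1
    congr 1
    funext i
    have := h2 i (by omega)
    simp only [cc, dif_pos i.2] at this
    exact Nat.add_right_cancel this
  · intro r hr
    simp only [Finset.mem_filter, mem_lsts] at hr
    obtain ⟨hl, hg⟩ := hr
    obtain ⟨c, w, hp, rfl⟩ := ins_surj _ r le_rfl
    have hb := blow_ins c w y hp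
    rw [← hl] at hg
    obtain ⟨hg', hs⟩ := (hb.good_iff nn (by simpa using hy)).1 hg
    have hl' := hb.L_eq
    rw [hs] at hl'
    have hM : M = w.length := by omega
    subst hM
    have hcc : ∀ g, g ≤ w.length →
        cc y w.length w (fun i => c i - if Pk (Hl y w) w.length i then 1 else 0) g = c g := by
      intro g hgl
      simp only [cc, dif_pos (show g < w.length + 1 by omega)]
      split_ifs with hk
      · have := hb.hc g hk; omega
      · omega
    refine ⟨(w, fun i => c i - if Pk (Hl y w) w.length i then 1 else 0), ?_, ?_⟩
    · simp only [Finset.mem_product, Finset.mem_filter, mem_lsts,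
        Finset.Nat.mem_antidiagonalTuple]
      refine ⟨⟨trivial, hg'⟩, ?_⟩
      have hs2 := cc_sum y w.length w
        (fun i => c i - if Pk (Hl y w) w.length i then 1 else 0) (fun _ => 1)
      simp only [one_mul, Finset.sum_const, smul_eq_mul, mul_one] at hs2
      rw [Finset.sum_congr rfl (fun g hg => hcc g (by simp at hg; omega)), hs, hg'.card,
        Fin.sum_univ_succ] at hs2
      omega
    · have key : ∀ (w : List (Fin 3)) (c c2 : ℕ → ℕ), (∀ g, g ≤ w.length → c g = c2 g) →
          ins c w = ins c2 w := by
        intro w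
        induction w with
        | nil => intro c c2 h; simp [ins, h 0]
        | cons a w ih =>
          intro c c2 h
          simp only [ins]
          rw [h 0 (by omega), ih _ (fun g => c2 (g + 1)) (fun g hg => h (g + 1) (by simpa using hg))]
      exact key w _ _ hcc
  · rintro ⟨w, c⟩ hx
    simp only [Finset.mem_product, Finset.mem_filter, mem_lsts,
      Finset.Nat.mem_antidiagonalTuple] at hx ⊢
    obtain ⟨⟨rfl, hg⟩, hc⟩ := hx
    have hb := blow_ins _ w y (cc_PC y w c)
    have hs := cc_sum y w.length w c (fun _ => 1)
    simp only [one_mul, Finset.sum_const, smul_eq_mul, mul_one] at hs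
    rw [hc, hg.card, ← Fin.sum_univ_succ] at hs
    have hl := hb.L_eq
    rw [hs] at hl
    have hw := hb.weight
    rw [hs, cc_sum y w.length w c (fun g => g), hl] at hw
    rw [← pow_add, ← pow_add]
    congr 1
    unfold wt
    rw [hw]
    ring

theorem AA_shift (q : ℂ) (ν : ℕ) (nn : Fin (ν + 1) → ℕ) (L : ℕ) :
    AA q (ν + 1) nn ((ν : ℤ) + 1) (L + 1) = q ^ (∑ j, nn j) * AA q (ν + 1) nn ν L := by
  unfold AA
  rw [Finset.mul_sum]
  symm
  have hh : ∀ w k, Hl ((ν : ℤ) + 1) (1 :: w) (k + 1) = Hl ν w k := by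
    intro w k; simp [stepVal]
  have h0 : ∀ w, Hl ((ν : ℤ) + 1) (1 :: w) 0 = Hl ν w 0 + 1 := by
    intro w; simp
  refine Finset.sum_bij (fun w _ => 1 :: w) ?_ ?_ ?_ ?_
  · intro w hw
    simp only [Finset.mem_filter, mem_lsts] at hw ⊢
    exact ⟨by simp [hw.1], (sh_good (hh w) (h0 w) (by simp) nn).2 hw.2⟩
  · intro a _ b _ hab; simpa using hab
  · intro r hr
    simp only [Finset.mem_filter, mem_lsts] at hr
    obtain ⟨hl, hg⟩ := hr
    cases r with
    | nil => simp at hl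
    | cons a w =>
      have hle := hg.1.le_of_pk (by simp) hg.2.1 1 (by omega)
      have hv := hg.1.1 0 (by omega)
      have hst := Hl_step (a :: w) ((ν : ℤ) + 1) 0 (by simp)
      simp only [Hl_zero, List.getElem_cons_zero, zero_add] at hst hv
      push_cast at hle
      have : a = 1 := stepVal_eq_neg.1 (by omega)
      subst this
      refine ⟨w, ?_, rfl⟩
      simp only [Finset.mem_filter, mem_lsts]
      exact ⟨by simpa using hl, (sh_good (hh w) (h0 w) (by simp) nn).1 hg⟩
  · intro w hw
    simp only [Finset.mem_filter, mem_lsts] at hw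
    rw [sh_wt (hh w) (h0 w), hw.2.card, pow_add, mul_comm]

theorem AA_zero (q : ℂ) (nn : Fin 0 → ℕ) (L : ℕ) : AA q 0 nn 0 L = 1 := by
  unfold AA
  have hH : ∀ k, Hl 0 (List.replicate L (2 : Fin 3)) k = 0 := by
    induction L with
    | zero => intro k; rfl
    | succ L ih =>
      intro k
      cases k with
      | zero => simp
      | succ k => simp only [List.replicate_succ, Hl_cons]; simpa [stepVal] using ih k
  have hs : (lsts L).filter (fun w => Good 0 nn (Hl 0 w) L) = {List.replicate L 2} := by
    ext w
    simp only [Finset.mem_filter, mem_lsts, Finset.mem_singleton]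
    constructor
    · rintro ⟨hl, hg⟩
      refine List.eq_replicate_iff.2 ⟨hl, fun b hb => ?_⟩
      obtain ⟨k, hk, rfl⟩ := List.getElem_of_mem hb
      have hle := hg.1.le_of_pk (ν := 0) (by simp) hg.2.1
      have a1 := hle k (by omega)
      have a2 := hle (k + 1) (by omega)
      have a3 := hg.1.nonneg k (by omega)
      have a4 := hg.1.nonneg (k + 1) (by omega)
      have := Hl_step w 0 k hk
      exact stepVal_eq_zero.1 (by push_cast at *; omega)
    · rintro rfl
      refine ⟨by simp, ⟨fun k _ => ?_, hH _, by simp⟩, fun k _ => by simp [hH], fun j => j.elim0⟩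
      right; right; simp [hH]
  rw [hs, Finset.sum_singleton]
  have : pks (Hl 0 (List.replicate L (2 : Fin 3))) L = ∅ := by
    ext k
    simp only [mem_pks, Finset.notMem_empty, iff_false]
    rintro ⟨_, _, h3, _⟩
    simp [hH] at h3
  simp [wt, this]

theorem hsum_succ (q : ℂ) (k n : ℕ) :
    hsum q (k + 1) n = ∑ b ∈ Finset.range (n + 1), q ^ b * hsum q k b := by
  have h1 : hsum q (k + 1) n =
      ∑ x ∈ Finset.HasAntidiagonal.antidiagonal n, q ^ x.2 * hsum q k x.2 := by
    unfold hsum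
    rw [Finset.sum_congr rfl (fun x _ => Finset.mul_sum _ _ _), Finset.sum_sigma']
    refine Finset.sum_bij' (fun c _ => ⟨(c 0, ∑ i : Fin k, c i.succ), fun i => c i.succ⟩)
      (fun x _ => Fin.cons x.1.1 x.2) ?_ ?_ ?_ ?_ ?_
    · intro c hc
      rw [Finset.Nat.mem_antidiagonalTuple, Fin.sum_univ_succ] at hc
      simp only [Finset.mem_sigma, Finset.HasAntidiagonal.mem_antidiagonal, Finset.Nat.mem_antidiagonalTuple]
      exact ⟨hc, trivial⟩
    · rintro ⟨⟨a, b⟩, c⟩ hc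
      simp only [Finset.mem_sigma, Finset.HasAntidiagonal.mem_antidiagonal,
        Finset.Nat.mem_antidiagonalTuple] at hc ⊢
      rw [Fin.sum_univ_succ]
      simp only [Fin.cons_zero, Fin.cons_succ]
      omega
    · intro c _
      funext i
      refine Fin.cases ?_ (fun j => ?_) i <;> simp
    · rintro ⟨⟨a, b⟩, c⟩ hc
      simp only [Finset.mem_sigma, Finset.HasAntidiagonal.mem_antidiagonal,
        Finset.Nat.mem_antidiagonalTuple] at hc
      obtain ⟨_, rfl⟩ := hc
      simp
    · intro c _
      simp only
      rw [← pow_add, Fin.sum_univ_succ]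
      congr 1
      simp only [Fin.val_zero, zero_mul, zero_add, Fin.val_succ, add_mul, one_mul,
        Finset.sum_add_distrib]
      ring
  rw [h1, Finset.Nat.sum_antidiagonal_eq_sum_range_succ_mk]
  rw [← Finset.sum_range_reflect]
  refine Finset.sum_congr rfl fun j hj => ?_
  simp only [Finset.mem_range] at hj
  simp only
  rw [show n - (n + 1 - 1 - j) = j by omega]

theorem hsum_zero_right (q : ℂ) (k : ℕ) : hsum q k 0 = 1 := by
  simp [hsum, Finset.Nat.antidiagonalTuple_zero_right]

theorem hsum_closed (q : ℂ) (n : ℕ) : ∀ k, hsum q k n * qP q n =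
    ∏ j ∈ Finset.range n, (1 - q ^ (k + j)) := by
  induction n with
  | zero => intro k; simp [hsum_zero_right, qP]
  | succ n ih =>
    intro k
    induction k with
    | zero =>
      simp [hsum, Finset.prod_range_succ']
    | succ k ihk =>
      have h1 : hsum q (k + 1) (n + 1) = hsum q (k + 1) n + q ^ (n + 1) * hsum q k (n + 1) := by
        rw [hsum_succ, Finset.sum_range_succ, ← hsum_succ]
      have h2 : qP q (n + 1) = qP q n * (1 - q ^ (n + 1)) := by
        simp [qP, Finset.prod_range_succ]
      have h3 : ∏ j ∈ Finset.range (n + 1), (1 - q ^ (k + j)) =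
          (∏ j ∈ Finset.range n, (1 - q ^ (k + 1 + j))) * (1 - q ^ k) := by
        rw [Finset.prod_range_succ']
        simp [add_assoc, add_comm 1]
      rw [h1, add_mul, mul_assoc, ihk, h2, ← mul_assoc, ih, h3, Finset.prod_range_succ]
      ring

theorem qP_ne_zero (q : ℂ) (hq : ‖q‖ < 1) (n : ℕ) : qP q n ≠ 0 := by
  unfold qP
  refine Finset.prod_ne_zero_iff.2 fun j _ h => ?_
  have h1 : q ^ (j + 1) = 1 := by linear_combination -h
  have h2 : ‖q‖ ^ (j + 1) < 1 := pow_lt_one₀ (norm_nonneg _) hq (by omega)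
  rw [← norm_pow, h1] at h2
  simp at h2

theorem hsum_tendsto (q : ℂ) (hq : ‖q‖ < 1) (n : ℕ) :
    Filter.Tendsto (fun k => hsum q k n) Filter.atTop (nhds (1 / qP q n)) := by
  have h1 : ∀ k, hsum q k n = (∏ j ∈ Finset.range n, (1 - q ^ (k + j))) / qP q n := by
    intro k
    rw [eq_div_iff (qP_ne_zero q hq n), hsum_closed]
  simp only [h1]
  refine Filter.Tendsto.div_const ?_ _
  have h2 : Filter.Tendsto (fun k => ∏ j ∈ Finset.range n, (1 - q ^ (k + j))) Filter.atTop
      (nhds (∏ j ∈ Finset.range n, (1 - 0))) := by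
    refine tendsto_finsetProd _ fun j _ => ?_
    refine Filter.Tendsto.const_sub _ ?_
    exact (Filter.tendsto_add_atTop_iff_nat (f := fun k => q ^ k) j).2
      (tendsto_pow_atTop_nhds_zero_of_norm_lt_one hq)
  simpa using h2

theorem NN_one {ν : ℕ} (nn : Fin ν → ℕ) : NN nn 1 = ∑ j, nn j := by
  simp [NN]

theorem NN_succ {ν : ℕ} (nn : Fin (ν + 1) → ℕ) (i : ℕ) (hi : 1 ≤ i) :
    NN nn (i + 1) = NN (fun j => nn j.succ) i := by
  unfold NN
  rw [Fin.sum_univ_succ]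
  rw [if_neg (by simp; omega), zero_add]
  refine Finset.sum_congr rfl fun j _ => ?_
  simp

theorem sum_NN_shift {ν : ℕ} (nn : Fin (ν + 1) → ℕ) (F : ℕ → ℕ) (a : ℕ) (ha : 1 ≤ a) :
    ∑ i ∈ Finset.Icc (a + 1) (ν + 1), F (NN nn i) =
      ∑ i ∈ Finset.Icc a ν, F (NN (fun j => nn j.succ) i) := by
  symm
  refine Finset.sum_bij (fun i _ => i + 1) ?_ ?_ ?_ ?_
  · intro i hi; simp at hi ⊢; omega
  · intro i _ j _ h; simpa using h
  · intro i hi; simp at hi; exact ⟨i - 1, by simp; omega, by omega⟩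
  · intro i hi; simp at hi; rw [NN_succ nn i (by omega)]

theorem expAG_succ (ν s : ℕ) (nn : Fin (ν + 1) → ℕ) :
    expAG (ν + 1) (s + 1) nn = (∑ j, nn j) ^ 2 + expAG ν s (fun j => nn j.succ) := by
  unfold expAG
  rw [← Finset.add_sum_Ioc_eq_sum_Icc (by omega : 1 ≤ ν + 1), ← Finset.Icc_add_one_left_eq_Ioc,
    sum_NN_shift nn (fun x => x ^ 2) 1 le_rfl, sum_NN_shift nn (fun x => x) (s + 1) (by omega),
    NN_one, add_assoc]

theorem expAG_zero (ν : ℕ) (nn : Fin (ν + 1) → ℕ) :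
    expAG (ν + 1) 0 nn = (∑ j, nn j) + ((∑ j, nn j) ^ 2 + expAG ν 0 (fun j => nn j.succ)) := by
  unfold expAG
  simp only [zero_add]
  rw [← Finset.add_sum_Ioc_eq_sum_Icc (by omega : 1 ≤ ν + 1), ← Finset.Icc_add_one_left_eq_Ioc,
    ← Finset.add_sum_Ioc_eq_sum_Icc (by omega : 1 ≤ ν + 1), ← Finset.Icc_add_one_left_eq_Ioc,
    sum_NN_shift nn (fun x => x ^ 2) 1 le_rfl, sum_NN_shift nn (fun x => x) 1 le_rfl,
    NN_one]
  ring

theorem AA_tendsto (q : ℂ) (hq : ‖q‖ < 1) (ν : ℕ) : ∀ (s : ℕ) (_ : s ≤ ν) (nn : Fin ν → ℕ),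
    Filter.Tendsto (fun L => AA q ν nn ((ν : ℤ) - s) L) Filter.atTop
      (nhds (q ^ expAG ν s nn / ∏ i : Fin ν, qP q (nn i))) := by
  induction ν with
  | zero =>
    intro s hs nn
    have : s = 0 := by omega
    subst this
    have h1 : ∀ L, AA q 0 nn (((0 : ℕ) : ℤ) - ((0 : ℕ) : ℤ)) L = 1 := by
      intro L; simpa using AA_zero q nn L
    simp only [h1]
    simp [expAG]
  | succ ν ih =>
    have main : ∀ (s : ℕ) (_ : s ≤ ν) (nn : Fin (ν + 1) → ℕ),
        Filter.Tendsto (fun L => AA q (ν + 1) nn ((ν : ℤ) - s) L) Filter.atTop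
        (nhds (q ^ ((∑ j, nn j) ^ 2 + expAG ν s (fun j => nn j.succ)) /
          ∏ i : Fin (ν + 1), qP q (nn i))) := by
      intro s hs nn
      rw [← Filter.tendsto_add_atTop_iff_nat (2 * ∑ j, nn j)]
      simp only [AA_rec q ν nn ((ν : ℤ) - s) (by omega)]
      have h1 := ((ih s hs (fun j => nn j.succ)).mul
        ((Filter.tendsto_add_atTop_iff_nat 1).2 (hsum_tendsto q hq (nn 0)))).const_mul
          (q ^ ((∑ j, nn j) ^ 2))
      convert h1 using 2
      rw [Fin.prod_univ_succ, pow_add]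
      have := qP_ne_zero q hq (nn 0)
      have : ∏ i : Fin ν, qP q (nn i.succ) ≠ 0 :=
        Finset.prod_ne_zero_iff.2 fun i _ => qP_ne_zero q hq _
      field_simp
    intro s hs nn
    cases s with
    | zero =>
      rw [← Filter.tendsto_add_atTop_iff_nat 1]
      have h1 : ∀ L, AA q (ν + 1) nn (((ν + 1 : ℕ) : ℤ) - ((0 : ℕ) : ℤ)) (L + 1) =
          q ^ (∑ j, nn j) * AA q (ν + 1) nn ((ν : ℤ) - ((0 : ℕ) : ℤ)) L := by
        intro L
        have := AA_shift q ν nn L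
        simpa using this
      simp only [h1]
      have h2 := (main 0 (by omega) nn).const_mul (q ^ (∑ j, nn j))
      rw [← mul_div_assoc, ← pow_add, ← expAG_zero] at h2
      exact h2
    | succ s =>
      have h2 := main s (by omega) nn
      rw [← expAG_succ] at h2
      have h3 : ((ν + 1 : ℕ) : ℤ) - ((s + 1 : ℕ) : ℤ) = (ν : ℤ) - s := by push_cast; ring
      rw [h3]
      exact h2

/-! ### Bridge to the frozen definitions -/

theorem hts_eq {n : ℕ} (y : ℤ) (d : Fin n → Fin 3) : ∀ k, k ≤ n →
    hts y d k = Hl y (List.ofFn d) k := by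
  intro k
  induction k with
  | zero => intro _; simp [hts]
  | succ k ih =>
    intro hk
    have h1 : hts y d (k + 1) = hts y d k + stepVal (d ⟨k, hk⟩) := by
      simp only [hts, Finset.sum_range_succ]
      rw [dif_pos (show k < n by omega)]; ring
    rw [h1, ih (by omega), Hl_step _ _ _ (by simpa using hk)]
    simp

theorem isPeak_iff {n : ℕ} (y : ℤ) (d : Fin n → Fin 3) (k : ℕ) :
    IsPeak d k ↔ Pk (Hl y (List.ofFn d)) n k := by
  have hl : (List.ofFn d).length = n := by simp
  cases k with
  | zero =>
    constructor
    · rintro ⟨_, h, _⟩; omega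
    · rintro ⟨h, _⟩; omega
  | succ k =>
    have h := pk_Hl (y := y) (w := List.ofFn d) (k := k)
    rw [hl] at h
    rw [h]
    constructor
    · rintro ⟨hk, _, h1, h2⟩
      simp only [Nat.add_sub_cancel] at h1
      rw [List.getElem?_eq_getElem (by rw [hl]; omega), List.getElem?_eq_getElem (by rw [hl]; omega)]
      simp [h1, h2]
    · rintro ⟨h1, h2⟩
      obtain ⟨b1, c1⟩ := List.getElem?_eq_some_iff.1 h1
      obtain ⟨b2, c2⟩ := List.getElem?_eq_some_iff.1 h2
      rw [List.getElem_ofFn] at c1 c2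
      exact ⟨by omega, by omega, c1, c2⟩

theorem relProp_eq {n : ℕ} (y : ℤ) (d : Fin n → Fin 3) (k : ℕ) (hk : k ≤ n) :
    RelProp y d k = RP (Hl y (List.ofFn d)) n k := by
  funext t
  apply propext
  unfold RelProp RP
  refine and_congr Iff.rfl (exists_congr fun k' => exists_congr fun k'' => ?_)
  constructor
  · rintro ⟨h1, h2, h3, h4, h5, h6⟩
    rw [hts_eq y d _ (by omega), hts_eq y d _ (by omega)] at h4 h5
    refine ⟨h1, h2, h3, h4, h5, fun m hm1 hm2 hm => ?_⟩
    have := h6 m hm1 hm2 ((isPeak_iff y d m).2 hm)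
    rwa [hts_eq y d _ (by omega), hts_eq y d _ (by omega)] at this
  · rintro ⟨h1, h2, h3, h4, h5, h6⟩
    rw [← hts_eq y d _ (by omega), ← hts_eq y d _ (by omega)] at h4 h5
    refine ⟨h1, h2, h3, h4, h5, fun m hm1 hm2 hm => ?_⟩
    have := h6 m hm1 hm2 ((isPeak_iff y d m).1 hm)
    rwa [← hts_eq y d _ (by omega), ← hts_eq y d _ (by omega)] at this

theorem valid_iff {n : ℕ} (ν : ℕ) (y : ℤ) (hy : 0 ≤ y) (d : Fin n → Fin 3) :
    ValidPath ν y 0 d ↔ (VP (Hl y (List.ofFn d)) n ∧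
      ∀ k, Pk (Hl y (List.ofFn d)) n k → Hl y (List.ofFn d) k ≤ ν) := by
  have hst : ∀ k (hk : k < n), Hl y (List.ofFn d) (k + 1) =
      Hl y (List.ofFn d) k + stepVal (d ⟨k, hk⟩) := by
    intro k hk
    have := Hl_step (List.ofFn d) y k (by simpa using hk)
    simpa using this
  unfold ValidPath VP
  rw [hts_eq y d n le_rfl]
  constructor
  · rintro ⟨h1, h2, h3⟩
    refine ⟨⟨fun k hk => ?_, h1, by simpa using hy⟩, fun k hk => ?_⟩
    · have h4 := h2 ⟨k, hk⟩
      rw [hts_eq y d _ (by simp; omega)] at h4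
      have h5 := hst k hk
      have h6 : d ⟨k, hk⟩ = 0 ∨ d ⟨k, hk⟩ = 1 ∨ d ⟨k, hk⟩ = 2 := by
        generalize d ⟨k, hk⟩ = a
        fin_cases a <;> simp
      rcases h6 with h6 | h6 | h6
      · rw [stepVal_eq_one.2 h6] at h5; left; exact h5
      · rw [stepVal_eq_neg.2 h6] at h5; right; left; exact ⟨by omega, h4.1 h6⟩
      · rw [stepVal_eq_zero.2 h6] at h5; right; right; exact ⟨by omega, h4.2 h6⟩
    · rw [← hts_eq y d k (by have := hk.2.1; omega)]
      exact h3 k ((isPeak_iff y d k).2 hk)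
  · rintro ⟨⟨h1, h2, h3⟩, h4⟩
    refine ⟨h2, fun k => ?_, fun k hk => ?_⟩
    · have h5 := hst k k.2
      have h6 := h1 k k.2
      rw [hts_eq y d _ k.2.le]
      constructor
      · intro h7
        rw [stepVal_eq_neg.2 h7] at h5; omega
      · intro h7
        rw [stepVal_eq_zero.2 h7] at h5; omega
    · have hk' := (isPeak_iff y d k).1 hk
      rw [hts_eq y d k (by have := hk'.2.1; omega)]
      exact h4 k hk'

theorem pset_iff {n : ℕ} (ν : ℕ) (y : ℤ) (hy : 0 ≤ y) (nn : Fin ν → ℕ) (d : Fin n → Fin 3) :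
    (ValidPath ν y 0 d ∧ ∀ j : Fin ν, ((Finset.range (n + 1)).filter
      (fun k => IsPeak d k ∧ relHt ν y d k = (j : ℕ) + 1)).card = nn j) ↔
    Good ν nn (Hl y (List.ofFn d)) n := by
  rw [valid_iff ν y hy, Good, and_assoc]
  refine and_congr_right fun hV => and_congr_right fun hP => forall_congr' fun j => ?_
  have : (Finset.range (n + 1)).filter
      (fun k => IsPeak d k ∧ relHt ν y d k = (j : ℕ) + 1) =
      (pks (Hl y (List.ofFn d)) n).filter
        (fun k => Ex (Hl y (List.ofFn d)) n k ((j : ℕ) + 1)) := by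
    rw [pks, Finset.filter_filter]
    refine Finset.filter_congr fun k _ => ?_
    rw [isPeak_iff y d k]
    refine and_congr_right fun hk => ?_
    unfold relHt
    rw [relProp_eq y d k (by have := hk.2.1; omega)]
    exact hV.findGreatest_iff (by have := hP k hk; push_cast; omega) (by omega)
  rw [this]
  rfl

theorem pwt_eq {n : ℕ} (y : ℤ) (d : Fin n → Fin 3) :
    pwt 0 d = (wt (Hl y (List.ofFn d)) n : ℤ) := by
  unfold pwt wt pks
  rw [Finset.sum_filter]
  push_cast
  refine Finset.sum_congr rfl fun k _ => ?_
  simp only [isPeak_iff y d k, zero_add]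

theorem sum_eq_AA (q : ℂ) (ν : ℕ) (y : ℤ) (hy : 0 ≤ y) (nn : Fin ν → ℕ) (n : ℕ) :
    ∑ d ∈ Finset.univ.filter (fun d : Fin n → Fin 3 => ValidPath ν y 0 d ∧
      ∀ j : Fin ν, ((Finset.range (n + 1)).filter
      (fun k => IsPeak d k ∧ relHt ν y d k = (j : ℕ) + 1)).card = nn j), q ^ pwt 0 d
      = AA q ν nn y n := by
  unfold AA lsts
  rw [Finset.filter_image, Finset.sum_image (fun a _ b _ h => List.ofFn_injective h)]
  refine Finset.sum_congr (Finset.filter_congr fun d _ => pset_iff ν y hy nn d) fun d _ => ?_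
  rw [pwt_eq y d, zpow_natCast]

theorem stmt_2 (ν : ℕ) (hν : 1 ≤ ν) (s : ℕ) (hs : s ≤ ν) (nn : Fin ν → ℕ)
    (q : ℂ) (hq : ‖q‖ < 1) :
    Filter.Tendsto
      (fun L : ℕ => ∑ d ∈ Pset ν 0 (L : ℤ) ((ν : ℤ) - s) 0 nn, q ^ pwt 0 d)
      Filter.atTop
      (nhds (q ^ expAG ν s nn / ∏ i : Fin ν, qP q (nn i))) := by
  have h1 : ∀ L : ℕ, ∑ d ∈ Pset ν 0 (L : ℤ) ((ν : ℤ) - s) 0 nn, q ^ pwt 0 d =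
      AA q ν nn ((ν : ℤ) - s) L := by
    intro L
    have h2 := sum_eq_AA q ν ((ν : ℤ) - s) (by omega) nn ((L : ℤ) - 0).toNat
    have h3 : ((L : ℤ) - 0).toNat = L := by simp
    refine Eq.trans ?_ (h2.trans (by rw [h3]))
    rfl
  simp only [h1]
  exact AA_tendsto q hq ν s hs nn

end
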